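/- arXiv:1110.5888 — 2 statements merged into one kernel-verified Lean document; each statement's English description precedes it below -/
import Mathlib

section
/- Let n ≥ 1, k ≥ 3, α ≥ 0, and let f : S_k^n → [k] be an SCF with D(f, NONMANIP-bar) ≤ α. Then either D(f, NONMANIP(n,k)) < 100 · n^4 · k^8 · α^{1/3}, or P(σ ∈ M_3(f)) ≥ α (and hence P(σ ∈ M(f)) ≥ α), where σ is uniform on S_k^n. -/
open Finset

/-- `a` is ranked above `b` in the ranking `τ` (a ranking maps positions to
alternatives; earlier positions are better). -/
def Above {k : ℕ} (τ : Equiv.Perm (Fin k)) (a b : Fin k) : Prop :=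
  τ.symm a < τ.symm b

/-- Uniform probability of an event over a finite type. -/
noncomputable def prob {Ω : Type*} [Fintype Ω] (p : Ω → Prop) : ℝ := by
  classical exact ((Finset.univ.filter p).card : ℝ) / (Fintype.card Ω : ℝ)

/-- Number of elements satisfying an event, as a real number. -/
noncomputable def count {Ω : Type*} [Fintype Ω] (p : Ω → Prop) : ℝ := by
  classical exact ((Finset.univ.filter p).card : ℝ)

/-- A ranking profile for `n` voters and `k` alternatives. -/
abbrev Profile (n k : ℕ) := Fin n → Equiv.Perm (Fin k)

/-- `(σ, σ')` is a manipulation pair for `f` at coordinate `i`: they differ exactly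
in coordinate `i` and voter `i` truly prefers `f σ'` to `f σ`. -/
def IsManipPairAt {n k : ℕ} (f : Profile n k → Fin k) (σ σ' : Profile n k) (i : Fin n) : Prop :=
  σ i ≠ σ' i ∧ (∀ j, j ≠ i → σ j = σ' j) ∧ Above (σ i) (f σ') (f σ)

/-- `σ` is a manipulation point of `f`, i.e. `σ ∈ M(f)`. -/
def IsManipPoint {n k : ℕ} (f : Profile n k → Fin k) (σ : Profile n k) : Prop :=
  ∃ σ' i, IsManipPairAt f σ σ' i

/-- `τ` and `τ'` agree outside a block of at most `r` consecutive positions. -/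
def AgreeOutsideBlock {k : ℕ} (r : ℕ) (τ τ' : Equiv.Perm (Fin k)) : Prop :=
  ∃ l : ℕ, ∀ p : Fin k, ((p : ℕ) < l ∨ l + r ≤ (p : ℕ)) → τ p = τ' p

/-- `σ` is an `r`-manipulation point of `f`, i.e. `σ ∈ M_r(f)`. -/
def IsManipPointR {n k : ℕ} (r : ℕ) (f : Profile n k → Fin k) (σ : Profile n k) : Prop :=
  ∃ σ' i, IsManipPairAt f σ σ' i ∧ AgreeOutsideBlock r (σ i) (σ' i)

/-- `f` always elects the top alternative of `H` according to voter `i`. -/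
def IsTopOn {n k : ℕ} (f : Profile n k → Fin k) (i : Fin n) (H : Finset (Fin k)) : Prop :=
  ∀ σ, f σ ∈ H ∧ ∀ b ∈ H, b ≠ f σ → Above (σ i) (f σ) b

/-- `f` takes exactly two values. -/
def TakesExactlyTwoValues {n k : ℕ} (f : Profile n k → Fin k) : Prop :=
  ∃ a b : Fin k, a ≠ b ∧ (∀ σ, f σ = a ∨ f σ = b) ∧ (∃ σ, f σ = a) ∧ (∃ σ, f σ = b)

/-- `f` is monotone: whenever `σ, σ'` differ in exactly one coordinate `i` and
`f σ ≠ f σ'`, voter `i` ranks `f σ'` above `f σ` in `σ' i`. -/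
def IsMonotone {n k : ℕ} (f : Profile n k → Fin k) : Prop :=
  ∀ (σ σ' : Profile n k) (i : Fin n),
    σ i ≠ σ' i → (∀ j, j ≠ i → σ j = σ' j) → f σ ≠ f σ' → Above (σ' i) (f σ') (f σ)

/-- The family `NONMANIP(n,k)` of nonmanipulable social choice functions. -/
def InNonManip {n k : ℕ} (f : Profile n k → Fin k) : Prop :=
  (∃ (i : Fin n) (H : Finset (Fin k)), H.Nonempty ∧ IsTopOn f i H) ∨
  (TakesExactlyTwoValues f ∧ IsMonotone f)

/-- The family `NONMANIP-bar`: functions depending on one coordinate only,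
or taking at most two values. -/
def InNonManipBar {n k : ℕ} (f : Profile n k → Fin k) : Prop :=
  (∃ i : Fin n, ∀ σ σ' : Profile n k, σ i = σ' i → f σ = f σ') ∨
  (∃ a b : Fin k, ∀ σ, f σ = a ∨ f σ = b)

/-- `σ` lies in the fiber `F(z^{a,b})`: `z i = true` iff voter `i` prefers `a` to `b`. -/
def InFiber {n k : ℕ} (a b : Fin k) (z : Fin n → Bool) (σ : Profile n k) : Prop :=
  ∀ i, Above (σ i) a b ↔ z i = true

/-- `σ` is on the boundary `B_i^{a,b}(f)`: `f σ = a` and some `σ'` differing from `σ`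
only in coordinate `i` has `f σ' = b`. -/
def OnBoundaryB {n k : ℕ} (f : Profile n k → Fin k) (i : Fin n) (a b : Fin k)
    (σ : Profile n k) : Prop :=
  f σ = a ∧ ∃ σ' : Profile n k, σ i ≠ σ' i ∧ (∀ j, j ≠ i → σ j = σ' j) ∧ f σ' = b

/-- `σ ∈ B_i(z^{a,b})`. -/
def InBFiber {n k : ℕ} (f : Profile n k → Fin k) (i : Fin n) (a b : Fin k)
    (z : Fin n → Bool) (σ : Profile n k) : Prop :=
  InFiber a b z σ ∧ OnBoundaryB f i a b σ

/-- The fiber `B_i(z^{a,b})` is large (for the parameter `ε`):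
`P(σ ∈ B_i(z^{a,b}) | σ ∈ F(z^{a,b})) ≥ 1 - ε^3/(4 n^3 k^9)`. -/
def IsLargeFiber {n k : ℕ} (f : Profile n k → Fin k) (ε : ℝ) (i : Fin n) (a b : Fin k)
    (z : Fin n → Bool) : Prop :=
  1 - ε ^ 3 / (4 * (n : ℝ) ^ 3 * (k : ℝ) ^ 9) ≤
    prob (fun σ : Profile n k => InBFiber f i a b z σ) /
      prob (fun σ : Profile n k => InFiber a b z σ)

/-- `σ ∈ Lg(B_i^{a,b})`, the union of the large fibers. -/
def InLg {n k : ℕ} (f : Profile n k → Fin k) (ε : ℝ) (i : Fin n) (a b : Fin k)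
    (σ : Profile n k) : Prop :=
  ∃ z, IsLargeFiber f ε i a b z ∧ InBFiber f i a b z σ

/-- `σ ∈ Sm(B_i^{a,b})`, the union of the small fibers. -/
def InSm {n k : ℕ} (f : Profile n k → Fin k) (ε : ℝ) (i : Fin n) (a b : Fin k)
    (σ : Profile n k) : Prop :=
  ∃ z, ¬ IsLargeFiber f ε i a b z ∧ InBFiber f i a b z σ

/-- Two profiles differ in exactly one coordinate. -/
def AdjOneCoord {n k : ℕ} (σ π : Profile n k) : Prop :=
  ∃ i, σ i ≠ π i ∧ ∀ j, j ≠ i → σ j = π j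

/-- `σ` belongs to the vertex boundary `∂(B_i(z^{a,b}))` of `B_i(z^{a,b})` inside the
fiber `F(z^{a,b})`. -/
def InFiberBdry {n k : ℕ} (f : Profile n k → Fin k) (i : Fin n) (a b : Fin k)
    (z : Fin n → Bool) (σ : Profile n k) : Prop :=
  InBFiber f i a b z σ ∧
    ∃ π, AdjOneCoord σ π ∧ InFiber a b z π ∧ ¬ InBFiber f i a b z π

/-- `σ₋ᵢ ∈ D_i(a,b)`: fixing all coordinates except `i` according to `σ`, the induced
one-voter SCF equals `top_H` for some `H ⊇ {a,b}` with `|H| ≥ 3`. -/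
def InD1 {n k : ℕ} (f : Profile n k → Fin k) (i : Fin n) (a b : Fin k)
    (σ : Profile n k) : Prop :=
  ∃ H : Finset (Fin k), a ∈ H ∧ b ∈ H ∧ 3 ≤ H.card ∧
    ∀ τ : Equiv.Perm (Fin k),
      f (Function.update σ i τ) ∈ H ∧
        ∀ c ∈ H, c ≠ f (Function.update σ i τ) → Above τ (f (Function.update σ i τ)) c


namespace GS

section counting
open Classical

/-- natural number counting -/
noncomputable def cn {Ω : Type*} [Fintype Ω] (p : Ω → Prop) : ℕ :=
  (Finset.univ.filter p).card

variable {α β ι : Type*} [Fintype α] [Fintype β] [Fintype ι]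

lemma prob_eq (p : α → Prop) : prob p = (cn p : ℝ) / (Fintype.card α : ℝ) := rfl

lemma cn_mono {p q : α → Prop} (h : ∀ x, p x → q x) : cn p ≤ cn q :=
  Finset.card_le_card (fun x hx => by
    simp only [Finset.mem_filter, Finset.mem_univ, true_and] at *
    exact h x hx)

lemma cn_le_card (p : α → Prop) : cn p ≤ Fintype.card α := Finset.card_le_univ _

lemma cn_true {p : α → Prop} (h : ∀ x, p x) : cn p = Fintype.card α := by
  have : Finset.univ.filter p = Finset.univ := Finset.filter_true_of_mem (fun x _ => h x)
  unfold cn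
  rw [this]; rfl

lemma cn_sum (p : α → Prop) : cn p = ∑ x, if p x then 1 else 0 := by
  unfold cn; rw [Finset.card_filter]

lemma cn_or (p q : α → Prop) : cn (fun x => p x ∨ q x) ≤ cn p + cn q := by
  unfold cn
  convert Finset.card_union_le (Finset.univ.filter p) (Finset.univ.filter q)
  ext x; simp

lemma cn_exists (p : ι → α → Prop) : cn (fun x => ∃ i, p i x) ≤ ∑ i, cn (p i) := by
  unfold cn
  convert (Finset.card_biUnion_le (s := (Finset.univ : Finset ι)) (t := fun i => Finset.univ.filter (p i)))
  ext x; simp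

lemma cn_exists_le (p : ι → α → Prop) (c : ℕ) (h : ∀ i, cn (p i) ≤ c) :
    cn (fun x => ∃ i, p i x) ≤ Fintype.card ι * c := by
  refine (cn_exists p).trans ?_
  refine (Finset.sum_le_card_nsmul _ _ c (fun i _ => h i)).trans ?_
  simp

lemma cn_inj (f : α → β) (hf : Function.Injective f) (p : β → Prop) :
    cn (fun x => p (f x)) ≤ cn p := by
  unfold cn
  refine Finset.card_le_card_of_injOn f ?_ hf.injOn
  intro x hx
  simpa using hx

lemma cn_equiv (f : α ≃ β) (p : β → Prop) : cn (fun x => p (f x)) = cn p := by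
  apply le_antisymm (cn_inj f f.injective p)
  have := cn_inj f.symm f.symm.injective (fun x => p (f x))
  simpa using this

lemma cn_prod (p : α × β → Prop) : cn p = ∑ x, cn (fun y => p (x, y)) := by
  simp only [cn_sum]; rw [Fintype.sum_prod_type]

lemma cn_prod' (p : α × β → Prop) : cn p = ∑ y, cn (fun x => p (x, y)) := by
  simp only [cn_sum]; rw [Fintype.sum_prod_type_right]

lemma cn_snd (p : β → Prop) : cn (fun x : α × β => p x.2) = Fintype.card α * cn p := by
  rw [cn_prod]; simp

lemma cn_fst (p : α → Prop) : cn (fun x : α × β => p x.1) = Fintype.card β * cn p := by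
  rw [cn_prod']; simp

/-- averaging -/
lemma exists_avg [Nonempty α] (F : α → ℕ) (c : ℕ) (h : ∑ x, F x ≤ Fintype.card α * c) :
    ∃ x, F x ≤ c := by
  by_contra hcon
  push Not at hcon
  have : ∑ x : α, c < ∑ x, F x :=
    Finset.sum_lt_sum_of_nonempty Finset.univ_nonempty (fun x _ => hcon x)
  simp at this
  omega

end counting

section paths

/-- The path starting at `g` with successive right multiplications meets `B`. -/
def Hits {G : Type*} [Group G] (B : G → Prop) : List G → G → Prop
  | [], g => B g
  | s :: L, g => B g ∨ Hits B L (g * s)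

lemma Hits.start {G : Type*} [Group G] {B : G → Prop} {L : List G} {g : G} (h : B g) :
    Hits B L g := by
  cases L with
  | nil => exact h
  | cons s L => exact Or.inl h

lemma Hits.finish {G : Type*} [Group G] {B : G → Prop} {L : List G} {g : G}
    (h : B (g * L.prod)) : Hits B L g := by
  induction L generalizing g with
  | nil => simpa [Hits] using h
  | cons s L ih =>
    refine Or.inr (ih ?_)
    simpa [mul_assoc] using h

lemma hits_mono {G : Type*} [Group G] {B B' : G → Prop} (hB : ∀ g, B g → B' g) {L : List G}
    {g : G} (h : Hits B L g) : Hits B' L g := by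
  induction L generalizing g with
  | nil => exact hB _ h
  | cons s L ih => exact h.imp (hB _) ih

lemma cn_hits {G : Type*} [Group G] [Fintype G] (B : G → Prop) (L : List G) :
    cn (Hits B L) ≤ (L.length + 1) * cn B := by
  induction L with
  | nil => simp [Hits]
  | cons s L ih =>
    have h1 : cn (Hits B (s :: L)) ≤ cn B + cn (fun g => Hits B L (g * s)) := cn_or _ _
    have h2 : cn (fun g => Hits B L (g * s)) = cn (Hits B L) := cn_equiv (Equiv.mulRight s) _
    rw [h2] at h1
    simp only [List.length_cons]
    nlinarith

lemma hits_inv {G C : Type*} [Group G] (B : G → Prop) (F : G → C) (L : List G)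
    (hF : ∀ s ∈ L, ∀ g, ¬ B g → ¬ B (g * s) → F (g * s) = F g) (g : G)
    (hg : ¬ Hits B L g) : F (g * L.prod) = F g := by
  induction L generalizing g with
  | nil => simp
  | cons s L ih =>
    have hg' : ¬ B g ∧ ¬ Hits B L (g * s) := by simpa [Hits] using hg
    have := ih (fun s hs => hF s (List.mem_cons_of_mem _ hs)) (g * s) hg'.2
    rw [List.prod_cons, ← mul_assoc, this]
    exact hF s List.mem_cons_self g hg'.1 (fun hb => hg'.2 (Hits.start hb))

/-- Mixing lemma. `S` indexes copies (e.g. fibers). -/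
lemma mixing {S G C : Type*} [Fintype S] [Group G] [Fintype G]
    (B : S → G → Prop) (F : S → G → C) (gens : G → Prop) (l : ℕ)
    (hw : ∀ π : G, ∃ L : List G, (∀ s ∈ L, gens s) ∧ L.prod = π ∧ L.length ≤ l)
    (hF : ∀ z s, gens s → ∀ g, ¬ B z g → ¬ B z (g * s) → F z (g * s) = F z g) :
    ∃ ρ : G, cn (fun x : S × G => F x.1 x.2 ≠ F x.1 ρ) ≤
      (l + 1) * cn (fun x : S × G => B x.1 x.2) := by
  apply exists_avg (fun ρ : G => cn (fun x : S × G => F x.1 x.2 ≠ F x.1 ρ))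
  have h1 : ∀ π : G, cn (fun x : S × G => F x.1 (x.2 * π) ≠ F x.1 x.2) ≤
      (l + 1) * cn (fun x : S × G => B x.1 x.2) := by
    intro π
    obtain ⟨L, hL, rfl, hl⟩ := hw π
    rw [cn_prod, cn_prod, Finset.mul_sum]
    apply Finset.sum_le_sum
    intro z _
    have h3 : cn (fun y => F z (y * L.prod) ≠ F z y) ≤ cn (Hits (B z) L) := by
      apply cn_mono
      intro g hg
      by_contra hcon
      exact hg (hits_inv (B z) (F z) L (fun s hs => hF z s (hL s hs)) g hcon)
    refine h3.trans ((cn_hits _ _).trans ?_)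
    exact Nat.mul_le_mul_right _ (by omega)
  have h2 : ∑ ρ : G, cn (fun x : S × G => F x.1 x.2 ≠ F x.1 ρ) =
      ∑ π : G, cn (fun x : S × G => F x.1 (x.2 * π) ≠ F x.1 x.2) := by
    have e1 := cn_prod' (fun y : (S × G) × G => F y.1.1 y.1.2 ≠ F y.1.1 y.2)
    have e2 := cn_prod' (fun y : (S × G) × G => F y.1.1 (y.1.2 * y.2) ≠ F y.1.1 y.1.2)
    rw [← e1, ← e2]
    let e : (S × G) × G ≃ (S × G) × G :=
      { toFun := fun y => ((y.1.1, y.1.2 * y.2), y.1.2)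
        invFun := fun y => ((y.1.1, y.2), y.2⁻¹ * y.1.2)
        left_inv := fun y => by simp
        right_inv := fun y => by simp }
    rw [← cn_equiv e]
    rfl
  rw [h2]
  refine (Finset.sum_le_card_nsmul _ _ _ (fun π _ => h1 π)).trans ?_
  simp

end paths
section words

/-- adjacent transposition of positions `p, p+1` -/
def adj {m : ℕ} (p : Fin m) : Equiv.Perm (Fin (m + 1)) := Equiv.swap p.castSucc p.succ

def IsAdj {m : ℕ} (s : Equiv.Perm (Fin (m + 1))) : Prop := ∃ p, s = adj p

lemma word_swap {m : ℕ} (p : Fin (m + 1)) : ∃ L : List (Equiv.Perm (Fin (m + 1))),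
    (∀ s ∈ L, IsAdj s) ∧ L.prod = Equiv.swap 0 p ∧ L.length ≤ 2 * (p : ℕ) := by
  induction p using Fin.induction with
  | zero => exact ⟨[], by simp, by simp; rfl, by simp⟩
  | succ p ih =>
    obtain ⟨L, h1, h2, h3⟩ := ih
    by_cases hp : p.castSucc = 0
    · refine ⟨[adj p], by simp [IsAdj], ?_, by simp; omega⟩
      simp [adj, hp]
    · refine ⟨adj p :: (L ++ [adj p]), ?_, ?_, ?_⟩
      · intro s hs
        simp only [List.mem_cons, List.mem_append, List.not_mem_nil, or_false] at hs
        rcases hs with rfl | hs | rfl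
        · exact ⟨p, rfl⟩
        · exact h1 s hs
        · exact ⟨p, rfl⟩
      · simp only [List.prod_cons, List.prod_append, List.prod_nil, mul_one, h2, adj]
        rw [← mul_assoc, Equiv.swap_mul_swap_mul_swap (Ne.symm hp) (Fin.succ_ne_zero p).symm,
          Equiv.swap_comm]
      · simp at h3 ⊢; omega

/-- lift of a permutation to one more position fixing position `0` and putting `a` first -/
def lft {m : ℕ} (a : Fin (m + 1)) (e : Equiv.Perm (Fin m)) : Equiv.Perm (Fin (m + 1)) :=
  Equiv.Perm.decomposeFin.symm (a, e)

lemma lft_zero {m : ℕ} (a : Fin (m + 1)) (e : Equiv.Perm (Fin m)) : lft a e 0 = a := by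
  simp [lft]

lemma lft_succ {m : ℕ} (a : Fin (m + 1)) (e : Equiv.Perm (Fin m)) (x : Fin m) :
    lft a e x.succ = Equiv.swap 0 a (e x).succ := by
  simp [lft]

lemma lft_mul {m : ℕ} (a : Fin (m + 1)) (e e' : Equiv.Perm (Fin m)) :
    lft a (e * e') = lft a e * lft 0 e' := by
  ext x
  refine Fin.cases ?_ (fun y => ?_) x
  · simp [lft_zero]
  · simp [lft_succ]

lemma lft_swap {m : ℕ} (a : Fin (m + 1)) (e : Equiv.Perm (Fin m)) :
    lft a e = Equiv.swap 0 a * lft 0 e := by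
  ext x
  refine Fin.cases ?_ (fun y => ?_) x
  · simp [lft_zero]
  · simp [lft_succ]

lemma lft_adj {m : ℕ} (p : Fin m) : lft 0 (adj p) = adj p.succ := by
  ext x
  refine Fin.cases ?_ (fun y => ?_) x
  · simp only [lft_zero, adj]
    rw [Equiv.swap_apply_of_ne_of_ne]
    · intro h; exact absurd (congrArg Fin.val h) (by simp)
    · exact (Fin.succ_ne_zero _).symm
  · simp only [lft_succ, adj, Equiv.swap_self, Equiv.refl_apply]
    have h1 : p.succ.castSucc = (p.castSucc).succ := rfl
    rw [h1]
    have := (Fin.succ_injective (m + 1)).swap_apply p.castSucc p.succ y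
    rw [this]

lemma word_perm (m : ℕ) (π : Equiv.Perm (Fin (m + 1))) :
    ∃ L : List (Equiv.Perm (Fin (m + 1))),
    (∀ s ∈ L, IsAdj s) ∧ L.prod = π ∧ L.length ≤ (m + 1) ^ 2 := by
  induction m with
  | zero => exact ⟨[], by simp, by
      ext x
      have h1 := (π x).isLt
      have h2 := x.isLt
      simp, by simp⟩
  | succ m ih =>
    obtain ⟨⟨p, e⟩, rfl⟩ := Equiv.Perm.decomposeFin.symm.surjective π
    obtain ⟨L, h1, h2, h3⟩ := word_swap p
    obtain ⟨L', h1', h2', h3'⟩ := ih e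
    refine ⟨L ++ L'.map (lft 0), ?_, ?_, ?_⟩
    · intro s hs
      simp only [List.mem_append, List.mem_map] at hs
      rcases hs with hs | ⟨t, ht, rfl⟩
      · exact h1 s hs
      · obtain ⟨q, rfl⟩ := h1' t ht
        exact ⟨q.succ, lft_adj q⟩
    · have : ∀ M : List (Equiv.Perm (Fin (m + 1))), (M.map (lft 0)).prod = lft 0 M.prod := by
        intro M
        induction M with
        | nil =>
          ext x
          refine Fin.cases ?_ (fun y => ?_) x
          · simp [lft_zero]
          · simp [lft_succ]
        | cons s M ihM => simp [ihM, lft_mul]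
      rw [List.prod_append, this, h2, h2']
      exact (lft_swap p e).symm
    · have := p.isLt
      simp only [List.length_append, List.length_map]
      nlinarith

lemma word_profile (n m : ℕ) (π : Fin n → Equiv.Perm (Fin (m + 1))) :
    ∃ L : List (Fin n → Equiv.Perm (Fin (m + 1))),
    (∀ s ∈ L, ∃ i p, s = Pi.mulSingle i (adj p)) ∧ L.prod = π ∧ L.length ≤ n * (m + 1) ^ 2 := by
  have key : ∀ S : Finset (Fin n), ∃ L : List (Fin n → Equiv.Perm (Fin (m + 1))),
      (∀ s ∈ L, ∃ i p, s = Pi.mulSingle i (adj p)) ∧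
      L.prod = (fun j => if j ∈ S then π j else 1) ∧ L.length ≤ S.card * (m + 1) ^ 2 := by
    intro S
    induction S using Finset.induction_on with
    | empty => exact ⟨[], by simp, by simp; rfl, by simp⟩
    | insert i S hi ih =>
      obtain ⟨L, h1, h2, h3⟩ := ih
      obtain ⟨L', h1', h2', h3'⟩ := word_perm m (π i)
      refine ⟨L ++ L'.map (Pi.mulSingle i), ?_, ?_, ?_⟩
      · intro s hs
        simp only [List.mem_append, List.mem_map] at hs
        rcases hs with hs | ⟨t, ht, rfl⟩
        · exact h1 s hs
        · obtain ⟨q, rfl⟩ := h1' t ht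
          exact ⟨i, q, rfl⟩
      · have : ∀ M : List (Equiv.Perm (Fin (m + 1))), (M.map (Pi.mulSingle i)).prod =
            (Pi.mulSingle i M.prod : Fin n → Equiv.Perm (Fin (m + 1))) := by
          intro M
          induction M with
          | nil => simp
          | cons s M ihM => simp [ihM, Pi.mulSingle_mul]
        rw [List.prod_append, this, h2, h2']
        funext j
        by_cases hj : j = i
        · subst hj; simp [hi]
        · simp [hj, Finset.mem_insert]
      · rw [Finset.card_insert_of_notMem hi]
        simp only [List.length_append, List.length_map]
        nlinarith
  obtain ⟨L, h1, h2, h3⟩ := key Finset.univ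
  exact ⟨L, h1, by simpa using h2, by simpa using h3⟩

end words
section onevoter

variable {m : ℕ}

/-- Local nonmanipulability condition off `B`. -/
def LC (F : Equiv.Perm (Fin (m + 1)) → Fin (m + 1)) (B : Equiv.Perm (Fin (m + 1)) → Prop) : Prop :=
  ∀ τ p, ¬ B τ → ¬ B (τ * adj p) → F (τ * adj p) = F τ ∨
    (F τ = τ p.castSucc ∧ F (τ * adj p) = τ p.succ)

/-- Word moving the item in position `p` to the top. -/
def up : (p : ℕ) → p ≤ m → List (Equiv.Perm (Fin (m + 1)))
  | 0, _ => []
  | p + 1, h => adj ⟨p, h⟩ :: up p (Nat.le_of_succ_le h)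

lemma up_length (p : ℕ) (h : p ≤ m) : (up p h).length = p := by
  induction p with
  | zero => rfl
  | succ p ih => simp [up, ih]

lemma up_top (p : ℕ) (h : p ≤ m) (τ : Equiv.Perm (Fin (m + 1))) :
    (τ * (up p h).prod) 0 = τ ⟨p, Nat.lt_succ_of_le h⟩ := by
  induction p generalizing τ with
  | zero => simp [up]
  | succ p ih =>
    simp only [up, List.prod_cons]
    rw [← mul_assoc, ih]
    simp only [Equiv.Perm.mul_apply]
    congr 1
    exact Equiv.swap_apply_left _ _

lemma up_win {F : Equiv.Perm (Fin (m + 1)) → Fin (m + 1)} {B : Equiv.Perm (Fin (m + 1)) → Prop}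
    (hL : LC F B) (p : ℕ) (h : p ≤ m) (τ : Equiv.Perm (Fin (m + 1)))
    (hF : F τ = τ ⟨p, Nat.lt_succ_of_le h⟩) (hB : ¬ Hits B (up p h) τ) :
    F (τ * (up p h).prod) = F τ := by
  induction p generalizing τ with
  | zero => simp [up]
  | succ p ih =>
    simp only [up, List.prod_cons]
    have hB' : ¬ B τ ∧ ¬ Hits B (up p (Nat.le_of_succ_le h)) (τ * adj ⟨p, h⟩) := by
      simpa [Hits, up] using hB
    have h1 : F (τ * adj ⟨p, h⟩) = F τ := by
      rcases hL τ ⟨p, h⟩ hB'.1 (fun hb => hB'.2 (Hits.start hb)) with h2 | ⟨h2, h3⟩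
      · exact h2
      · rw [h3, hF]; rfl
    rw [← mul_assoc, ih _ _ _ hB'.2, h1]
    rw [h1, hF]
    simp only [Equiv.Perm.mul_apply]
    congr 1
    exact (Equiv.swap_apply_left _ _).symm

lemma up_other {F : Equiv.Perm (Fin (m + 1)) → Fin (m + 1)}
    {B : Equiv.Perm (Fin (m + 1)) → Prop}
    (hL : LC F B) (p : ℕ) (h : p ≤ m) (τ : Equiv.Perm (Fin (m + 1))) (q : Fin (m + 1))
    (hF : F τ = τ q) (hq : p < (q : ℕ)) (hB : ¬ Hits B (up p h) τ) :
    F (τ * (up p h).prod) = F τ := by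
  induction p generalizing τ with
  | zero => simp [up]
  | succ p ih =>
    simp only [up, List.prod_cons]
    have hB' : ¬ B τ ∧ ¬ Hits B (up p (Nat.le_of_succ_le h)) (τ * adj ⟨p, h⟩) := by
      simpa [Hits, up] using hB
    have h1 : F (τ * adj ⟨p, h⟩) = F τ := by
      rcases hL τ ⟨p, h⟩ hB'.1 (fun hb => hB'.2 (Hits.start hb)) with h2 | ⟨h2, h3⟩
      · exact h2
      · rw [hF] at h2
        have h4 := congrArg Fin.val (τ.injective h2)
        simp at h4
        omega
    rw [← mul_assoc, ih _ _ _ (by omega) hB'.2, h1]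
    rw [h1, hF]
    simp only [Equiv.Perm.mul_apply]
    congr 1
    refine (Equiv.swap_apply_of_ne_of_ne ?_ ?_).symm
    · intro h4; have h5 := congrArg Fin.val h4; simp at h5; omega
    · intro h4; have h5 := congrArg Fin.val h4; simp at h5; omega

def TopAt (H : Finset (Fin (m + 1))) (c : Fin (m + 1)) (τ : Equiv.Perm (Fin (m + 1))) : Prop :=
  c ∈ H ∧ ∀ b ∈ H, b ≠ c → Above τ c b

open Classical in
theorem one_voter (hm : 1 ≤ m) (F : Equiv.Perm (Fin (m + 1)) → Fin (m + 1))
    (B : Equiv.Perm (Fin (m + 1)) → Prop) (hL : LC F B) :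
    ∃ H : Finset (Fin (m + 1)), cn (fun τ => ¬ TopAt H (F τ) τ) ≤ 2 * (m + 1) ^ 5 * cn B := by
  obtain ⟨m, rfl⟩ : ∃ m', m = m' + 1 := ⟨m - 1, by omega⟩
  -- mixing for each `a`
  have mix : ∀ a : Fin (m + 1 + 1), ∃ ρ : Equiv.Perm (Fin (m + 1)),
      cn (fun e => (F (lft a e) = a) ≠ (F (lft a ρ) = a)) ≤ ((m + 1) ^ 2 + 1) * cn B := by
    intro a
    obtain ⟨ρ, hρ⟩ := mixing (S := Unit) (fun _ e => B (lft a e)) (fun _ e => (F (lft a e) = a))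
      IsAdj ((m + 1) ^ 2) (word_perm m) (by
        rintro _ s ⟨p, rfl⟩ e h1 h2
        rw [lft_mul, lft_adj] at h2 ⊢
        rcases hL _ _ h1 h2 with h3 | ⟨h3, h4⟩
        · rw [h3]
        · rw [h3, h4]
          have hne : ∀ q : Fin (m + 1), lft a e q.succ ≠ a := by
            intro q hq
            exact absurd ((lft a e).injective (hq.trans (lft_zero a e).symm)) (Fin.succ_ne_zero q)
          have e1 : p.succ.castSucc = p.castSucc.succ := rfl
          rw [e1]
          simp [hne])
    refine ⟨ρ, ?_⟩
    rw [cn_prod, cn_prod] at hρ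
    simp only [Finset.univ_unique, Finset.sum_singleton] at hρ
    refine hρ.trans (Nat.mul_le_mul_left _ ?_)
    refine cn_inj (lft a) ?_ B
    intro e e' h
    have := Equiv.Perm.decomposeFin.symm.injective h
    exact (Prod.ext_iff.1 this).2
  choose ρ hρ using mix
  let H : Finset (Fin (m + 1 + 1)) := Finset.univ.filter (fun a => F (lft a (ρ a)) = a)
  have hH : ∀ a, a ∈ H ↔ F (lft a (ρ a)) = a := by intro a; simp [H]
  let W : Equiv.Perm (Fin (m + 1 + 1)) → Prop := fun τ => (F τ = τ 0) ≠ (τ 0 ∈ H)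
  have hW : cn W ≤ (m + 2) * (((m + 1) ^ 2 + 1) * cn B) := by
    have h1 : cn W = cn (fun x : Fin (m + 1 + 1) × Equiv.Perm (Fin (m + 1)) =>
        W (lft x.1 x.2)) := (cn_equiv Equiv.Perm.decomposeFin.symm W).symm
    rw [h1, cn_prod]
    refine (Finset.sum_le_card_nsmul _ _ (((m + 1) ^ 2 + 1) * cn B) ?_).trans ?_
    · intro a _
      refine le_trans (cn_mono ?_) (hρ a)
      intro e he
      simpa only [W, lft_zero, hH] using he
    · simp
  refine ⟨H, ?_⟩
  have main : ∀ τ, ¬ TopAt H (F τ) τ → ∃ p : Fin (m + 1 + 1),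
      Hits (fun τ => B τ ∨ W τ) (up (p : ℕ) (Nat.le_of_lt_succ p.isLt)) τ := by
    intro τ hτ
    by_contra hcon
    push Not at hcon
    apply hτ
    have hcB : ∀ p : Fin (m + 1 + 1), ¬ Hits B (up (p : ℕ) (Nat.le_of_lt_succ p.isLt)) τ :=
      fun p hp => hcon p (hits_mono (fun _ h => Or.inl h) hp)
    have hcW : ∀ p : Fin (m + 1 + 1),
        ¬ W (τ * (up (p : ℕ) (Nat.le_of_lt_succ p.isLt)).prod) :=
      fun p hp => hcon p (Hits.finish (Or.inr hp))
    constructor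
    · have h1 := up_win hL _ (Nat.le_of_lt_succ (τ.symm (F τ)).isLt) τ (by simp) (hcB _)
      have h2 := hcW (τ.symm (F τ))
      simp only [W, up_top, h1, ne_eq, not_not] at h2
      simpa using h2
    · intro b hb hbF
      by_contra hab
      have hlt : τ.symm b < τ.symm (F τ) := by
        rcases lt_trichotomy (τ.symm b) (τ.symm (F τ)) with h | h | h
        · exact h
        · exact absurd (τ.symm.injective h) hbF
        · exact absurd h hab
      have h1 := up_other hL _ (Nat.le_of_lt_succ (τ.symm b).isLt) τ (τ.symm (F τ)) (by simp)
        hlt (hcB _)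
      have h2 := hcW (τ.symm b)
      simp only [W, up_top, h1, ne_eq, not_not] at h2
      simp only [Fin.eta, Equiv.apply_symm_apply, hb, eq_iff_iff, iff_true] at h2
      exact hbF h2.symm
  refine (cn_mono main).trans ?_
  refine (cn_exists_le _ ((m + 2) * (cn B + cn W)) ?_).trans ?_
  · intro p
    refine (cn_hits _ _).trans ?_
    rw [up_length]
    exact Nat.mul_le_mul (by omega) (cn_or _ _)
  · simp only [Fintype.card_fin]
    have h5 : cn W ≤ ((m + 2) * ((m + 1) ^ 2 + 1)) * cn B := by rw [mul_assoc]; exact hW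
    have h6 : (m + 2) * ((m + 1) ^ 2 + 1) + 1 ≤ 2 * (m + 2) ^ 3 := by nlinarith [sq_nonneg m]
    calc (m + 1 + 1) * ((m + 2) * (cn B + cn W))
        ≤ (m + 1 + 1) * ((m + 2) * (cn B + ((m + 2) * ((m + 1) ^ 2 + 1)) * cn B)) := by gcongr
      _ = (m + 2) ^ 2 * ((m + 2) * ((m + 1) ^ 2 + 1) + 1) * cn B := by ring
      _ ≤ (m + 2) ^ 2 * (2 * (m + 2) ^ 3) * cn B := by gcongr
      _ = 2 * (m + 1 + 1) ^ 5 * cn B := by ring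

end onevoter
section profile

variable {n m : ℕ}

lemma adj_order (p : Fin m) (x y : Fin (m + 1)) (hxy : x < y) (h : adj p y < adj p x) :
    x = p.castSucc ∧ y = p.succ := by
  simp only [adj, Equiv.swap_apply_def] at h
  simp only [Fin.lt_def, Fin.ext_iff, apply_ite Fin.val, Fin.val_castSucc, Fin.val_succ] at *
  split_ifs at h <;> omega

lemma lc_profile (f : Profile n (m + 1) → Fin (m + 1)) (σ : Profile n (m + 1)) (i : Fin n) :
    LC (fun τ => f (Function.update σ i τ))
      (fun τ => IsManipPointR 3 f (Function.update σ i τ)) := by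
  intro τ p h1 h2
  by_cases heq : f (Function.update σ i (τ * adj p)) = f (Function.update σ i τ)
  · exact Or.inl heq
  right
  change f (Function.update σ i τ) = _ ∧ f (Function.update σ i (τ * adj p)) = _
  have hne : τ ≠ τ * adj p := by
    intro h
    exact heq (by rw [← h])
  have hag : ∀ q : Fin (m + 1), ((q : ℕ) < p ∨ (p : ℕ) + 3 ≤ q) → τ q = (τ * adj p) q := by
    intro q hq
    simp only [Equiv.Perm.mul_apply, adj]
    rw [Equiv.swap_apply_of_ne_of_ne]
    · intro h; have := congrArg Fin.val h; simp at this; omega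
    · intro h; have := congrArg Fin.val h; simp at this; omega
  have k1 : ¬ Above τ (f (Function.update σ i (τ * adj p))) (f (Function.update σ i τ)) := by
    intro h
    refine h1 ⟨Function.update σ i (τ * adj p), i, ⟨by simpa using hne, ?_, by simpa using h⟩, p, ?_⟩
    · intro j hj; simp [hj]
    · intro q hq; simpa using hag q hq
  have k2 : ¬ Above (τ * adj p) (f (Function.update σ i τ))
      (f (Function.update σ i (τ * adj p))) := by
    intro h
    refine h2 ⟨Function.update σ i τ, i, ⟨by simpa using hne.symm, ?_, by simpa using h⟩, p, ?_⟩
    · intro j hj; simp [hj]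
    · intro q hq; simpa using (hag q hq).symm
  generalize f (Function.update σ i (τ * adj p)) = v at *
  generalize f (Function.update σ i τ) = u at *
  have a1 : τ.symm u < τ.symm v := by
    refine lt_of_le_of_ne (not_lt.1 k1) ?_
    intro h
    exact heq (τ.symm.injective h).symm
  have hs : ∀ x, (τ * adj p).symm x = adj p (τ.symm x) := by
    intro x
    rw [Equiv.symm_apply_eq]
    simp [adj]
  have a2 : adj p (τ.symm v) < adj p (τ.symm u) := by
    rw [← hs, ← hs]
    refine lt_of_le_of_ne (not_lt.1 k2) ?_
    intro h
    exact heq ((τ * adj p).symm.injective h)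
  obtain ⟨b1, b2⟩ := adj_order p _ _ a1 a2
  exact ⟨by rw [← b1]; simp, by rw [← b2]; simp⟩

lemma exists_avg2 {α : Type*} [Fintype α] [Nonempty α] (F : α → ℕ) :
    ∃ x, Fintype.card α * F x ≤ ∑ y, F y := by
  obtain ⟨x, _, hx⟩ := Finset.exists_min_image Finset.univ F Finset.univ_nonempty
  refine ⟨x, ?_⟩
  have := Finset.card_nsmul_le_sum Finset.univ F (F x) hx
  simpa using this

lemma cn_update (Bad : Profile n (m + 1) → Prop) (i : Fin n) :
    ∑ σ, cn (fun τ => Bad (Function.update σ i τ)) =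
      Fintype.card (Equiv.Perm (Fin (m + 1))) * cn Bad := by
  let e : Profile n (m + 1) × Equiv.Perm (Fin (m + 1)) ≃
      Profile n (m + 1) × Equiv.Perm (Fin (m + 1)) :=
    { toFun := fun x => (Function.update x.1 i x.2, x.1 i)
      invFun := fun x => (Function.update x.1 i x.2, x.1 i)
      left_inv := fun x => by simp
      right_inv := fun x => by simp }
  have h := cn_equiv e (fun x => Bad x.1)
  rw [cn_fst] at h
  rw [← h, cn_prod]
  rfl

/-- The top of `H`. -/
lemma exists_top (H : Finset (Fin (m + 1))) (hH : H.Nonempty) (τ : Equiv.Perm (Fin (m + 1))) :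
    ∃ c, TopAt H c τ := by
  obtain ⟨c, hc, hmin⟩ := Finset.exists_min_image H τ.symm hH
  refine ⟨c, hc, fun b hb hbc => lt_of_le_of_ne (hmin b hb) ?_⟩
  intro h
  exact hbc (τ.symm.injective h).symm

lemma top_unique {H : Finset (Fin (m + 1))} {τ : Equiv.Perm (Fin (m + 1))} {c d : Fin (m + 1)}
    (hc : TopAt H c τ) (hd : TopAt H d τ) : c = d := by
  by_contra h
  exact lt_asymm (hc.2 d hd.1 (Ne.symm h)) (hd.2 c hc.1 h)

theorem case_one (hm : 1 ≤ m) (f : Profile n (m + 1) → Fin (m + 1)) (i : Fin n)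
    (G : Equiv.Perm (Fin (m + 1)) → Fin (m + 1))
    (hsmall : 2 * (m + 1) ^ 5 * (cn (fun σ => IsManipPointR 3 f σ) + cn (fun σ => f σ ≠ G (σ i)))
      < Fintype.card (Profile n (m + 1))) :
    ∃ g, InNonManip g ∧ cn (fun σ => f σ ≠ g σ) ≤ cn (fun σ => f σ ≠ G (σ i)) +
      2 * (m + 1) ^ 5 * (cn (fun σ => IsManipPointR 3 f σ) + cn (fun σ => f σ ≠ G (σ i))) := by
  let Bad : Profile n (m + 1) → Prop := fun σ => IsManipPointR 3 f σ ∨ f σ ≠ G (σ i)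
  have hBad : cn Bad ≤ cn (fun σ => IsManipPointR 3 f σ) + cn (fun σ => f σ ≠ G (σ i)) := cn_or _ _
  obtain ⟨σ0, hσ0⟩ := exists_avg2 (fun σ : Profile n (m + 1) =>
    cn (fun τ => Bad (Function.update σ i τ)))
  rw [cn_update] at hσ0
  have hLC : LC G (fun τ => Bad (Function.update σ0 i τ)) := by
    intro τ p h1 h2
    simp only [Bad, not_or, not_not, Function.update_self, ne_eq] at h1 h2
    have := lc_profile f σ0 i τ p h1.1 h2.1
    simp only [h1.2, h2.2] at this
    exact this
  obtain ⟨H, hH⟩ := one_voter hm G _ hLC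
  have hcard : 0 < Fintype.card (Equiv.Perm (Fin (m + 1))) := Fintype.card_pos
  have hcount : cn (fun σ : Profile n (m + 1) => ¬ TopAt H (G (σ i)) (σ i)) ≤
      2 * (m + 1) ^ 5 * cn Bad := by
    have h1 := cn_update (fun σ : Profile n (m + 1) => ¬ TopAt H (G (σ i)) (σ i)) i
    simp only [Function.update_self, Finset.sum_const, Finset.card_univ, smul_eq_mul] at h1
    refine Nat.le_of_mul_le_mul_left ?_ hcard
    rw [← h1]
    calc _ ≤ Fintype.card (Profile n (m + 1)) * (2 * (m + 1) ^ 5 *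
          cn (fun τ => Bad (Function.update σ0 i τ))) := Nat.mul_le_mul_left _ hH
      _ = 2 * (m + 1) ^ 5 * (Fintype.card (Profile n (m + 1)) *
          cn (fun τ => Bad (Function.update σ0 i τ))) := by ring
      _ ≤ 2 * (m + 1) ^ 5 * (Fintype.card (Equiv.Perm (Fin (m + 1))) * cn Bad) :=
          Nat.mul_le_mul_left _ hσ0
      _ = _ := by ring
  have hcount' := hcount.trans (Nat.mul_le_mul_left (2 * (m + 1) ^ 5) hBad)
  have hne : H.Nonempty := by
    by_contra hcon
    rw [Finset.not_nonempty_iff_eq_empty] at hcon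
    subst hcon
    rw [cn_true (fun σ => by simp [TopAt])] at hcount'
    omega
  choose t ht using exists_top H hne
  refine ⟨fun σ => t (σ i), Or.inl ⟨i, H, hne, fun σ => ht (σ i)⟩, ?_⟩
  refine le_trans (cn_mono (q := fun σ => f σ ≠ G (σ i) ∨ ¬ TopAt H (G (σ i)) (σ i)) ?_)
    ((cn_or _ _).trans (Nat.add_le_add_left hcount' _))
  intro σ hσ
  by_contra hcon
  simp only [not_or, not_not, ne_eq] at hcon
  exact hσ (hcon.1.trans (top_unique hcon.2 (ht (σ i))))

end profile
section cube

variable {n : ℕ}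

/-- violation of monotonicity at `z` in direction `i` -/
def Viol (h : (Fin n → Bool) → Bool) (i : Fin n) (z : Fin n → Bool) : Prop :=
  h (Function.update z i false) = true ∧ h (Function.update z i true) = false

/-- sorting in direction `i` -/
def srt (i : Fin n) (h : (Fin n → Bool) → Bool) (z : Fin n → Bool) : Bool :=
  if z i = true then h (Function.update z i false) || h (Function.update z i true)
  else h (Function.update z i false) && h (Function.update z i true)

lemma srt_ne (i : Fin n) (h : (Fin n → Bool) → Bool) (z : Fin n → Bool)
    (hz : h z ≠ srt i h z) : Viol h i z := by
  unfold srt at hz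
  unfold Viol
  have hu : Function.update z i (z i) = z := Function.update_eq_self i z
  cases hzi : z i <;> rw [hzi] at hu <;> simp only [hzi, hu] at hz ⊢ <;> revert hz <;>
    generalize h (Function.update z i _) = x <;> cases h z <;> cases x <;> simp

lemma viol_srt_self (i : Fin n) (h : (Fin n → Bool) → Bool) (z : Fin n → Bool) :
    ¬ Viol (srt i h) i z := by
  simp only [Viol, srt, Function.update_self, Function.update_idem]
  cases h (Function.update z i false) <;> cases h (Function.update z i true) <;> simp

open Classical in
lemma viol_srt (i j : Fin n) (hij : j ≠ i) (h : (Fin n → Bool) → Bool) :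
    cn (Viol (srt i h) j) ≤ cn (Viol h j) := by
  let fl : (Fin n → Bool) ≃ (Fin n → Bool) :=
    { toFun := fun z => Function.update z i (!z i)
      invFun := fun z => Function.update z i (!z i)
      left_inv := fun z => by simp
      right_inv := fun z => by simp }
  have e1 := cn_equiv fl (Viol (srt i h) j)
  have e2 := cn_equiv fl (Viol h j)
  have key : cn (Viol (srt i h) j) + cn (fun z => Viol (srt i h) j (fl z)) ≤
      cn (Viol h j) + cn (fun z => Viol h j (fl z)) := by
    simp only [cn_sum, ← Finset.sum_add_distrib]
    apply Finset.sum_le_sum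
    intro z _
    have hu : Function.update z i (z i) = z := Function.update_eq_self i z
    have c1 : ∀ x y, Function.update (Function.update z j x) i y =
      Function.update (Function.update z i y) j x := fun x y => Function.update_comm hij _ _ _
    have hz : Function.update z j = Function.update (Function.update z i (z i)) j := by rw [hu]
    simp only [Viol, srt, fl, Equiv.coe_fn_mk, Function.update_of_ne hij.symm,
      Function.update_self, ← c1, Function.update_idem]
    rw [← hu]
    simp only [← c1, Function.update_idem, Function.update_self]
    cases z i <;> simp only [Bool.not_false, Bool.not_true] <;>
    generalize h (Function.update (Function.update z j false) i false) = x1 <;>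
    generalize h (Function.update (Function.update z j false) i true) = x2 <;>
    generalize h (Function.update (Function.update z j true) i false) = x3 <;>
    generalize h (Function.update (Function.update z j true) i true) = x4 <;>
    cases x1 <;> cases x2 <;> cases x3 <;> cases x4 <;> simp
  omega

lemma exists_mono (h : (Fin n → Bool) → Bool) :
    ∃ h' : (Fin n → Bool) → Bool, (∀ i z, ¬ Viol h' i z) ∧
      cn (fun z => h z ≠ h' z) ≤ ∑ i, cn (Viol h i) := by
  have key : ∀ S : Finset (Fin n), ∃ h' : (Fin n → Bool) → Bool, (∀ i ∈ S, cn (Viol h' i) = 0) ∧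
      (∀ i, cn (Viol h' i) ≤ cn (Viol h i)) ∧
      cn (fun z => h z ≠ h' z) ≤ ∑ i ∈ S, cn (Viol h i) := by
    intro S
    induction S using Finset.induction_on with
    | empty => exact ⟨h, by simp, by simp, by simp [cn]⟩
    | insert i S hi ih =>
      obtain ⟨h', h1, h2, h3⟩ := ih
      have h0 : cn (Viol (srt i h') i) = 0 := by
        simp [cn, viol_srt_self]
      have hle : ∀ j, cn (Viol (srt i h') j) ≤ cn (Viol h' j) := by
        intro j
        by_cases hj : j = i
        · subst hj; omega
        · exact viol_srt i j hj h'
      refine ⟨srt i h', ?_, fun j => (hle j).trans (h2 j), ?_⟩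
      · intro j hj
        rw [Finset.mem_insert] at hj
        rcases hj with rfl | hj
        · exact h0
        · have := hle j; have := h1 j hj; omega
      · rw [Finset.sum_insert hi]
        have h4 : cn (fun z => h z ≠ srt i h' z) ≤ cn (fun z => h z ≠ h' z) + cn (Viol h' i) := by
          refine le_trans (cn_mono ?_) (cn_or _ _)
          intro z hz
          by_cases hz' : h z = h' z
          · right
            rw [hz'] at hz
            exact srt_ne i h' z hz
          · exact Or.inl hz'
        have := h2 i
        omega
  obtain ⟨h', h1, _, h3⟩ := key Finset.univ
  refine ⟨h', ?_, h3⟩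
  intro i z hz
  have := h1 i (Finset.mem_univ i)
  simp only [cn, Finset.card_eq_zero, Finset.filter_eq_empty_iff] at this
  exact this (Finset.mem_univ z) hz

end cube
section casetwo

variable {n m : ℕ}

lemma above_asymm {k : ℕ} (τ : Equiv.Perm (Fin k)) (a b : Fin k) (hab : a ≠ b) :
    ¬ Above τ a b ↔ Above τ b a := by
  unfold Above
  rw [not_lt]
  constructor
  · intro h
    exact lt_of_le_of_ne h (fun h' => hab (τ.symm.injective h').symm)
  · exact le_of_lt

lemma above_swap {k : ℕ} (τ : Equiv.Perm (Fin k)) (a b : Fin k) (hab : a ≠ b) :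
    Above (Equiv.swap a b * τ) a b ↔ ¬ Above τ a b := by
  rw [above_asymm τ a b hab]
  have hs : ∀ x, (Equiv.swap a b * τ).symm x = τ.symm (Equiv.swap a b x) := by
    intro x
    rw [Equiv.symm_apply_eq]
    simp
  unfold Above
  rw [hs, hs]
  simp

open Classical in
/-- put a ranking into the half space `c` by exchanging the labels `a`, `b` if needed -/
noncomputable def nrm {k : ℕ} (a b : Fin k) (c : Bool) (τ : Equiv.Perm (Fin k)) :
    Equiv.Perm (Fin k) :=
  if decide (Above τ a b) = c then τ else Equiv.swap a b * τ

open Classical in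
lemma nrm_above {k : ℕ} {a b : Fin k} (hab : a ≠ b) (c : Bool) (τ : Equiv.Perm (Fin k)) :
    decide (Above (nrm a b c τ) a b) = c := by
  unfold nrm
  split_ifs with h
  · exact h
  · rw [Bool.eq_iff_iff] at *
    simp only [decide_eq_true_eq, above_swap τ a b hab] at *
    tauto

open Classical in
lemma nrm_inv {k : ℕ} {a b : Fin k} (hab : a ≠ b) (c : Bool) (τ : Equiv.Perm (Fin k)) :
    nrm a b (decide (Above τ a b)) (nrm a b c τ) = τ := by
  have h1 := nrm_above hab c τ
  unfold nrm at *
  split_ifs at * with h h2 h2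
  · rfl
  · exact absurd rfl h2
  · exact absurd (h1.symm.trans h2).symm h
  · rw [← mul_assoc, Equiv.swap_mul_self, one_mul]

lemma nrm_adj {a b : Fin (m + 1)} (hab : a ≠ b) (c : Bool) (τ : Equiv.Perm (Fin (m + 1)))
    (p : Fin m) :
    nrm a b c (τ * adj p) = nrm a b c τ ∨
    (nrm a b c (τ * adj p) = nrm a b c τ * adj p ∧
      ¬ (nrm a b c τ p.castSucc = a ∧ nrm a b c τ p.succ = b) ∧
      ¬ (nrm a b c τ p.castSucc = b ∧ nrm a b c τ p.succ = a)) := by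
  classical
  have hs : ∀ x, (τ * adj p).symm x = adj p (τ.symm x) := by
    intro x
    rw [Equiv.symm_apply_eq]
    simp [adj]
  by_cases h : (τ p.castSucc = a ∧ τ p.succ = b) ∨ (τ p.castSucc = b ∧ τ p.succ = a)
  · left
    have h1 : τ * adj p = Equiv.swap a b * τ := by
      have h2 : τ * adj p = Equiv.swap (τ p.castSucc) (τ p.succ) * τ := by
        unfold adj
        rw [Equiv.mul_swap_eq_swap_mul]
      rw [h2]
      rcases h with h | h
      · rw [h.1, h.2]
      · rw [h.1, h.2, Equiv.swap_comm]
    rw [h1]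
    have h3 := above_swap τ a b hab
    unfold nrm
    by_cases h4 : Above τ a b
    · cases c <;> simp [h3, h4]
    · cases c <;> simp [h3, h4, ← mul_assoc]
  · right
    have hord : Above (τ * adj p) a b ↔ Above τ a b := by
      have key : ∀ u v, u ≠ v → ¬ (τ p.castSucc = u ∧ τ p.succ = v) →
          Above τ u v → Above (τ * adj p) u v := by
        intro u v huv hn hA
        by_contra hcon
        rw [above_asymm _ _ _ huv] at hcon
        unfold Above at hcon hA
        rw [hs, hs] at hcon
        obtain ⟨h5, h6⟩ := adj_order p _ _ hA hcon
        exact hn ⟨by rw [← h5]; simp, by rw [← h6]; simp⟩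
      push Not at h
      constructor
      · intro hA
        by_contra hcon
        rw [above_asymm _ _ _ hab] at hcon
        have := key b a hab.symm (fun hh => h.2 hh.1 hh.2) hcon
        exact lt_asymm hA this
      · exact key a b hab (fun hh => h.1 hh.1 hh.2)
    unfold nrm
    simp only [hord]
    split_ifs with hc
    · refine ⟨rfl, ?_⟩
      tauto
    · refine ⟨(mul_assoc _ _ _).symm, ?_⟩
      have hsw : ∀ x y, Equiv.swap a b x = y ↔ x = Equiv.swap a b y := by
        intro x y
        rw [Equiv.swap_apply_eq_iff]
      simp only [Equiv.Perm.mul_apply, hsw, Equiv.swap_apply_left, Equiv.swap_apply_right]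
      tauto

/-- profile normalisation -/
noncomputable def Nrm (a b : Fin (m + 1)) (z : Fin n → Bool) (σ : Profile n (m + 1)) :
    Profile n (m + 1) := fun i => nrm a b (z i) (σ i)

open Classical in
/-- the fiber of a profile -/
noncomputable def zz (a b : Fin (m + 1)) (σ : Profile n (m + 1)) : Fin n → Bool :=
  fun i => decide (Above (σ i) a b)

/-- the involution -/
noncomputable def invo (n : ℕ) {a b : Fin (m + 1)} (hab : a ≠ b) :
    (Fin n → Bool) × Profile n (m + 1) ≃ (Fin n → Bool) × Profile n (m + 1) where
  toFun x := (zz a b x.2, Nrm a b x.1 x.2)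
  invFun x := (zz a b x.2, Nrm a b x.1 x.2)
  left_inv x := by
    apply Prod.ext
    · funext i; exact nrm_above hab _ _
    · funext i; exact nrm_inv hab _ _
  right_inv x := by
    apply Prod.ext
    · funext i; exact nrm_above hab _ _
    · funext i; exact nrm_inv hab _ _

lemma mul_single (σ : Profile n (m + 1)) (i : Fin n) (s : Equiv.Perm (Fin (m + 1))) :
    σ * Pi.mulSingle i s = Function.update σ i (σ i * s) := by
  funext j
  by_cases h : j = i
  · subst h; simp
  · simp [h]

lemma hits_update (B : Profile n (m + 1) → Prop) (i : Fin n) (L : List (Equiv.Perm (Fin (m + 1))))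
    (σ : Profile n (m + 1)) :
    Hits B (L.map (Pi.mulSingle i)) σ ↔ Hits (fun τ => B (Function.update σ i τ)) L (σ i) := by
  have key : ∀ τ, Hits B (L.map (Pi.mulSingle i)) (Function.update σ i τ) ↔
      Hits (fun τ => B (Function.update σ i τ)) L τ := by
    induction L with
    | nil => intro τ; simp [Hits]
    | cons s L ih =>
      intro τ
      simp only [List.map_cons, Hits, mul_single, Function.update_self, Function.update_idem, ih]
  have := key (σ i)
  rwa [Function.update_eq_self] at this

theorem case_two (f : Profile n (m + 1) → Fin (m + 1)) (a b : Fin (m + 1)) (hab : a ≠ b) (A : ℕ)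
    (hA : cn (fun σ => IsManipPointR 3 f σ) + cn (fun σ => ¬ (f σ = a ∨ f σ = b)) ≤ A) :
    ∃ g, (InNonManip g ∨ ∃ c, ∀ σ, g σ = c) ∧ cn (fun σ => f σ ≠ g σ) ≤
      (n * (m + 1) ^ 2 + 2) * A +
        n * ((m + 1) ^ 2 * (A + (n * (m + 1) ^ 2 + 2) * A)) := by
  classical
  let Bad : Profile n (m + 1) → Prop := fun σ => IsManipPointR 3 f σ ∨ ¬ (f σ = a ∨ f σ = b)
  have hBad : cn Bad ≤ A := (cn_or _ _).trans hA
  have h2n : 0 < Fintype.card (Fin n → Bool) := Fintype.card_pos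
  -- mixing in the fibers
  obtain ⟨ρ, hρ⟩ := mixing (S := Fin n → Bool) (G := Profile n (m + 1))
    (fun z σ => Bad (Nrm a b z σ)) (fun z σ => f (Nrm a b z σ))
    (fun s => ∃ i p, s = Pi.mulSingle i (adj p)) (n * (m + 1) ^ 2) (word_profile n m) (by
      rintro z s ⟨i, p, rfl⟩ σ h1 h2
      rw [mul_single] at h2 ⊢
      have hN : Nrm a b z (Function.update σ i (σ i * adj p)) =
          Function.update (Nrm a b z σ) i (nrm a b (z i) (σ i * adj p)) := by
        funext j
        by_cases hj : j = i
        · subst hj; simp [Nrm]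
        · simp [Nrm, hj]
      rw [hN] at h2 ⊢
      rcases nrm_adj hab (z i) (σ i) p with h3 | ⟨h3, h4, h5⟩
      · rw [h3]
        congr 1
        exact Function.update_eq_self i (Nrm a b z σ)
      · rw [h3] at h2 ⊢
        have h6 : nrm a b (z i) (σ i) = Nrm a b z σ i := rfl
        rw [h6] at *
        simp only [Bad, not_or] at h1 h2
        have h7 := lc_profile f (Nrm a b z σ) i (Nrm a b z σ i) p
          (by simpa using h1.1) h2.1
        simp only [Function.update_eq_self] at h7
        rcases h7 with h7 | ⟨h7, h8⟩
        · exact h7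
        · have h9 : f (Nrm a b z σ) = a ∨ f (Nrm a b z σ) = b := by tauto
          have h10 : f (Function.update (Nrm a b z σ) i (Nrm a b z σ i * adj p)) = a ∨
              f (Function.update (Nrm a b z σ) i (Nrm a b z σ i * adj p)) = b := by tauto
          rw [h7] at h9
          rw [h8] at h10
          rw [h7, h8]
          rcases h9 with h9 | h9 <;> rcases h10 with h10 | h10
          · rw [h9, h10]
          · exact absurd ⟨h9, h10⟩ h4
          · exact absurd ⟨h9, h10⟩ h5
          · rw [h9, h10])
  have hB2 : cn (fun x : (Fin n → Bool) × Profile n (m + 1) => Bad (Nrm a b x.1 x.2)) =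
      Fintype.card (Fin n → Bool) * cn Bad := by
    rw [← cn_snd]
    exact cn_equiv (invo n hab) (fun x => Bad x.2)
  have hE0 : cn (fun σ => f σ ≠ f (Nrm a b (zz a b σ) ρ)) ≤ (n * (m + 1) ^ 2 + 1) * cn Bad := by
    have e1 := cn_equiv (invo n hab) (fun x : (Fin n → Bool) × Profile n (m + 1) =>
      f (Nrm a b x.1 x.2) ≠ f (Nrm a b x.1 ρ))
    have e2 : (fun x => f (Nrm a b (invo n hab x).1 (invo n hab x).2) ≠
        f (Nrm a b (invo n hab x).1 ρ)) =
        (fun x : (Fin n → Bool) × Profile n (m + 1) => f x.2 ≠ f (Nrm a b (zz a b x.2) ρ)) := by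
      funext x
      have := congrArg Prod.snd ((invo n hab).left_inv x)
      have h3 : Nrm a b (invo n hab x).1 (invo n hab x).2 = x.2 := this
      rw [h3]; rfl
    rw [e2, cn_snd (fun σ => f σ ≠ f (Nrm a b (zz a b σ) ρ))] at e1
    rw [← e1, hB2] at hρ
    refine Nat.le_of_mul_le_mul_left (hρ.trans (le_of_eq ?_)) h2n
    ring
  let val : Bool → Fin (m + 1) := fun c => if c = true then a else b
  let h : (Fin n → Bool) → Bool := fun z => decide (f (Nrm a b z ρ) = a)
  let Er : Profile n (m + 1) → Prop := fun σ => f σ ≠ val (h (zz a b σ))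
  have hE : cn Er ≤ (n * (m + 1) ^ 2 + 2) * A := by
    have h1 : cn Er ≤ cn Bad + cn (fun σ => f σ ≠ f (Nrm a b (zz a b σ) ρ)) := by
      refine le_trans (cn_mono ?_) (cn_or _ _)
      intro σ hσ
      by_contra hcon
      simp only [not_or, not_not, ne_eq, Bad] at hcon
      apply hσ
      obtain ⟨⟨_, h3'⟩, h4⟩ := hcon
      have h3 : f σ = a ∨ f σ = b := by tauto
      simp only [h, ← h4, val]
      rcases h3 with h3 | h3
      · simp [h3]
      · simp [h3, hab.symm]
    calc cn Er ≤ cn Bad + (n * (m + 1) ^ 2 + 1) * cn Bad := by omega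
      _ = (n * (m + 1) ^ 2 + 2) * cn Bad := by ring
      _ ≤ _ := Nat.mul_le_mul_left _ hBad
  -- violations
  have hV : ∀ i, cn (fun σ => Viol h i (zz a b σ)) ≤ (m + 1) ^ 2 * (A + cn Er) := by
    intro i
    have main : ∀ σ, Viol h i (zz a b σ) → ∃ p : Fin (m + 1),
        Hits (fun σ => Bad σ ∨ Er σ)
          ((up (p : ℕ) (Nat.le_of_lt_succ p.isLt)).map (Pi.mulSingle i)) σ := by
      intro σ hσ
      by_contra hcon
      push Not at hcon
      simp only [hits_update] at hcon
      have hp := hcon ((σ i).symm (f σ))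
      have hM : ¬ Hits (fun τ => IsManipPointR 3 f (Function.update σ i τ)) _ _ :=
        fun hh => hp (hits_mono (fun τ ht => Or.inl (Or.inl ht)) hh)
      have w1 := up_win (lc_profile f σ i) _ _ (σ i) (by simp) hM
      have w2 := up_top ((σ i).symm (f σ) : ℕ)
        (Nat.le_of_lt_succ ((σ i).symm (f σ)).isLt) (σ i)
      have w3 := fun hh => hp (Hits.finish hh)
      have w0 := fun hh => hp (Hits.start hh)
      generalize σ i * (up ((σ i).symm (f σ) : ℕ) _).prod = τ at w1 w2 w3
      simp only [Function.update_eq_self, Fin.eta, Equiv.apply_symm_apply] at w0 w1 w2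
      simp only [Er, Bad, imp_false, not_or, not_not, ne_eq] at w0 w3
      obtain ⟨⟨_, w4'⟩, w5⟩ := w0
      have w4 : f σ = a ∨ f σ = b := by tauto
      have w6 := w3.2
      have hz : zz a b (Function.update σ i τ) =
          Function.update (zz a b σ) i (decide (Above τ a b)) := by
        funext j
        by_cases hj : j = i
        · subst hj; simp [zz]
        · simp [zz, hj]
      have hpos : ∀ d, d ≠ f σ → Above τ (f σ) d := by
        intro d hd
        have h0 : τ.symm (f σ) = 0 := by rw [Equiv.symm_apply_eq]; exact w2.symm
        unfold Above
        rw [h0]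
        refine Fin.pos_iff_ne_zero.2 ?_
        intro h1
        rw [← h0] at h1
        exact hd (τ.symm.injective h1)
      rw [w1, hz] at w6
      obtain ⟨v1, v2⟩ := hσ
      rcases w4 with w4 | w4
      · have hA1 : Above τ a b := by
          have := hpos b (by rw [w4]; exact hab.symm)
          rwa [w4] at this
        simp only [hA1, decide_true, v2, val] at w6
        exact hab (w4.symm.trans w6)
      · have hA1 : ¬ Above τ a b := by
          rw [above_asymm _ _ _ hab]
          have := hpos a (by rw [w4]; exact hab)
          rwa [w4] at this
        simp only [hA1, decide_false, v1, val, if_true] at w6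
        exact hab (w6.symm.trans w4)
    refine (cn_mono main).trans ?_
    refine (cn_exists_le _ ((m + 1) * (A + cn Er)) ?_).trans ?_
    · intro p
      refine (cn_hits _ _).trans ?_
      rw [List.length_map, up_length]
      exact Nat.mul_le_mul (by omega) ((cn_or _ _).trans (Nat.add_le_add_right hBad _))
    · simp only [Fintype.card_fin]
      apply le_of_eq; ring
  -- transfer between the cube and profiles
  have htr : ∀ P : (Fin n → Bool) → Prop, Fintype.card (Fin n → Bool) *
      cn (fun σ : Profile n (m + 1) => P (zz a b σ)) =
      Fintype.card (Profile n (m + 1)) * cn P := by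
    intro P
    rw [← cn_snd, ← cn_fst]
    exact cn_equiv (invo n hab) (fun x => P x.1)
  obtain ⟨h', hmono, hdist⟩ := exists_mono h
  have hd : cn (fun σ : Profile n (m + 1) => h (zz a b σ) ≠ h' (zz a b σ)) ≤
      n * ((m + 1) ^ 2 * (A + cn Er)) := by
    refine Nat.le_of_mul_le_mul_left ?_ h2n
    rw [htr (fun z => h z ≠ h' z)]
    calc _ ≤ Fintype.card (Profile n (m + 1)) * ∑ i, cn (Viol h i) := Nat.mul_le_mul_left _ hdist
      _ = ∑ i, Fintype.card (Profile n (m + 1)) * cn (Viol h i) := Finset.mul_sum _ _ _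
      _ = ∑ i, Fintype.card (Fin n → Bool) * cn (fun σ => Viol h i (zz a b σ)) := by
          simp only [htr]
      _ ≤ ∑ i : Fin n, Fintype.card (Fin n → Bool) * ((m + 1) ^ 2 * (A + cn Er)) :=
          Finset.sum_le_sum (fun i _ => Nat.mul_le_mul_left _ (hV i))
      _ = _ := by simp; ring
  refine ⟨fun σ => val (h' (zz a b σ)), ?_, ?_⟩
  · by_cases hc : ∃ c, ∀ σ : Profile n (m + 1), val (h' (zz a b σ)) = c
    · exact Or.inr hc
    · left; right
      have hv : ∀ c, val c = a ∨ val c = b := by intro c; cases c <;> simp [val]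
      constructor
      · refine ⟨a, b, hab, fun σ => hv _, ?_, ?_⟩
        · by_contra hn
          push Not at hn
          exact hc ⟨b, fun σ => (hv _).resolve_left (hn σ)⟩
        · by_contra hn
          push Not at hn
          exact hc ⟨a, fun σ => (hv _).resolve_right (hn σ)⟩
      · intro σ σ' i _ hj hne
        have hz' : ∀ c, Function.update (zz a b σ) i c = Function.update (zz a b σ') i c := by
          intro c
          funext j
          by_cases hji : j = i
          · subst hji; simp
          · simp [hji, zz, hj j hji]
        have hs := Function.update_eq_self i (zz a b σ)
        have hs' := Function.update_eq_self i (zz a b σ')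
        have hnv := hmono i (zz a b σ')
        have hz1 : zz a b σ' i = true ↔ Above (σ' i) a b := by simp [zz]
        unfold Viol at hnv
        change val (h' (zz a b σ)) ≠ val (h' (zz a b σ')) at hne
        rw [← hz'] at hs'
        rw [← hz', ← hz'] at hnv
        rw [← hs, ← hs'] at hne
        show Above (σ' i) (val (h' (zz a b σ'))) (val (h' (zz a b σ)))
        rw [← hs, ← hs']
        cases c1 : zz a b σ i <;> cases c2 : zz a b σ' i <;> rw [c1, c2] at hne
        · exact absurd rfl hne
        · cases d1 : h' (Function.update (zz a b σ) i false) <;>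
            cases d2 : h' (Function.update (zz a b σ) i true) <;>
            simp only [d1, d2] at hne hnv ⊢
          · exact absurd rfl hne
          · simpa [val] using hz1.1 c2
          · simp at hnv
          · exact absurd rfl hne
        · cases d1 : h' (Function.update (zz a b σ) i false) <;>
            cases d2 : h' (Function.update (zz a b σ) i true) <;>
            simp only [d1, d2] at hne hnv ⊢
          · exact absurd rfl hne
          · have : ¬ Above (σ' i) a b := by rw [← hz1, c2]; simp
            rw [above_asymm _ _ _ hab] at this
            simpa [val] using this
          · simp at hnv
          · exact absurd rfl hne
        · exact absurd rfl hne
  · have h1 : cn (fun σ => f σ ≠ val (h' (zz a b σ))) ≤ cn Er +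
        cn (fun σ : Profile n (m + 1) => h (zz a b σ) ≠ h' (zz a b σ)) := by
      refine le_trans (cn_mono ?_) (cn_or _ _)
      intro σ hσ
      by_contra hcon
      simp only [not_or, not_not, ne_eq, Er] at hcon
      apply hσ
      rw [← hcon.2]
      exact hcon.1
    refine h1.trans (Nat.add_le_add hE (hd.trans ?_))
    gcongr

end casetwo
theorem two_arith (n q A c T : ℝ) (hx : 9 ≤ n * q) (hA : 0 ≤ A)
    (h : c ≤ (n * q + 2) * A + n * (q * (A + (n * q + 2) * A))) (hT : A ≤ 2 * T) :
    c ≤ 4 * (n * q) ^ 2 * T := by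
  have e : (n * q + 2) * A + n * (q * (A + (n * q + 2) * A)) =
      ((n * q) ^ 2 + 4 * (n * q) + 2) * A := by ring
  rw [e] at h
  generalize n * q = x at *
  calc c ≤ _ := h
    _ ≤ (2 * x ^ 2) * A := by
        apply mul_le_mul_of_nonneg_right _ hA
        nlinarith
    _ ≤ (2 * x ^ 2) * (2 * T) := by gcongr
    _ = _ := by ring

end GS

open GS

theorem stmt2 (n k : ℕ) (hn : 1 ≤ n) (hk : 3 ≤ k) (α : ℝ) (hα : 0 ≤ α)
    (f : Profile n k → Fin k)
    (hD : ∃ g : Profile n k → Fin k, InNonManipBar g ∧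
      prob (fun σ : Profile n k => f σ ≠ g σ) ≤ α) :
    (∃ g : Profile n k → Fin k, InNonManip g ∧
        prob (fun σ : Profile n k => f σ ≠ g σ) <
          100 * (n : ℝ) ^ 4 * (k : ℝ) ^ 8 * α ^ ((1 : ℝ) / 3)) ∨
      (α ≤ prob (fun σ : Profile n k => IsManipPointR 3 f σ) ∧
        α ≤ prob (fun σ : Profile n k => IsManipPoint f σ)) := by
  have hmono3 : prob (fun σ : Profile n k => IsManipPointR 3 f σ) ≤
      prob (fun σ : Profile n k => IsManipPoint f σ) := by
    rw [prob_eq, prob_eq]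
    gcongr
    apply cn_mono
    rintro σ ⟨σ', i, h, _⟩
    exact ⟨σ', i, h⟩
  by_cases hM : α ≤ prob (fun σ : Profile n k => IsManipPointR 3 f σ)
  · exact Or.inr ⟨hM, hM.trans hmono3⟩
  left
  push Not at hM
  obtain ⟨m, rfl⟩ : ∃ m, k = m + 1 := ⟨k - 1, by omega⟩
  have hN : 0 < (Fintype.card (Profile n (m + 1)) : ℝ) := by
    exact_mod_cast Fintype.card_pos
  have hα0 : 0 < α := by
    refine lt_of_le_of_lt ?_ hM
    rw [prob_eq]; positivity
  -- the numeric reduction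
  have hn' : (1 : ℝ) ≤ n := by exact_mod_cast hn
  have hk' : (3 : ℝ) ≤ ((m + 1 : ℕ) : ℝ) := by exact_mod_cast hk
  set C : ℝ := 100 * (n : ℝ) ^ 4 * ((m + 1 : ℕ) : ℝ) ^ 8 with hC
  set t : ℝ := α ^ ((1 : ℝ) / 3) with ht
  have ht0 : 0 < t := Real.rpow_pos_of_pos hα0 _
  have ht3 : t ^ 3 = α := by
    rw [ht, ← Real.rpow_natCast, ← Real.rpow_mul hα]
    norm_num
  have hC0 : 0 < C := by positivity
  have hconst : ∀ g : Profile n (m + 1) → Fin (m + 1), (∃ c, ∀ σ, g σ = c) → InNonManip g := by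
    rintro g ⟨c, hg⟩
    refine Or.inl ⟨⟨0, hn⟩, {c}, by simp, fun σ => ⟨by simp [hg], ?_⟩⟩
    intro b hb hne
    rw [Finset.mem_singleton] at hb
    exact absurd (hb.trans (hg σ).symm) hne
  by_cases hbig : 1 < C * t
  · refine ⟨fun _ => 0, hconst _ ⟨0, fun _ => rfl⟩, lt_of_le_of_lt ?_ hbig⟩
    rw [prob_eq, div_le_one hN]
    exact_mod_cast cn_le_card _
  push Not at hbig
  have hCα : C ^ 3 * α ≤ 1 := by
    rw [← ht3, ← mul_pow]
    exact pow_le_one₀ (by positivity) hbig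
  have hx1 : (1 : ℝ) ≤ (n : ℝ) ^ 4 := one_le_pow₀ hn'
  have hCk : 100 * ((m + 1 : ℕ) : ℝ) ^ 8 ≤ C := by
    rw [hC]
    have : (0 : ℝ) ≤ ((m + 1 : ℕ) : ℝ) ^ 8 := by positivity
    nlinarith
  have hCn : 100 * (n : ℝ) ^ 2 * ((m + 1 : ℕ) : ℝ) ^ 4 ≤ C := by
    rw [hC]
    have h1 : (n : ℝ) ^ 2 ≤ (n : ℝ) ^ 4 := pow_le_pow_right₀ hn' (by norm_num)
    have h2 : ((m + 1 : ℕ) : ℝ) ^ 4 ≤ ((m + 1 : ℕ) : ℝ) ^ 8 :=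
      pow_le_pow_right₀ (by linarith) (by norm_num)
    gcongr
  have hC100 : 100 ≤ C := by
    have : (1 : ℝ) ≤ ((m + 1 : ℕ) : ℝ) ^ 8 := one_le_pow₀ (by linarith)
    linarith
  have hC1 : 1 ≤ C := by linarith
  have hC3 : C ≤ C ^ 3 := by
    have := pow_le_pow_right₀ hC1 (show 1 ≤ 3 by norm_num)
    simpa using this
  -- it is enough to have a bound `K * α` with `K < C`
  have hfin : ∀ (g : Profile n (m + 1) → Fin (m + 1)) (K : ℝ), K < C →
      (cn (fun σ => f σ ≠ g σ) : ℝ) ≤ K * (α * Fintype.card (Profile n (m + 1))) →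
      prob (fun σ : Profile n (m + 1) => f σ ≠ g σ) < C * t := by
    intro g K hK hg
    rw [prob_eq, div_lt_iff₀ hN]
    refine lt_of_le_of_lt hg ?_
    have htle : t ≤ 1 := by nlinarith
    have hαt : α ≤ t := by
      rw [← ht3]
      have := pow_le_pow_of_le_one ht0.le htle (show 1 ≤ 3 by norm_num)
      simpa using this
    calc K * (α * Fintype.card (Profile n (m + 1)))
        < C * (α * Fintype.card (Profile n (m + 1))) := by gcongr
      _ ≤ C * (t * Fintype.card (Profile n (m + 1))) := by gcongr
      _ = _ := by ring
  have hMc : (cn (fun σ => IsManipPointR 3 f σ) : ℝ) ≤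
      α * Fintype.card (Profile n (m + 1)) := by
    rw [prob_eq, div_lt_iff₀ hN] at hM
    exact hM.le
  obtain ⟨g0, hg0, hd0⟩ := hD
  rw [prob_eq, div_le_iff₀ hN] at hd0
  rcases hg0 with ⟨i, hi⟩ | ⟨a, b, hg0⟩
  · -- one coordinate
    let G : Equiv.Perm (Fin (m + 1)) → Fin (m + 1) := fun τ => g0 (fun _ => τ)
    have hG : ∀ σ, g0 σ = G (σ i) := fun σ => hi _ _ rfl
    simp only [hG] at hd0
    have hk58 : ((m + 1 : ℕ) : ℝ) ^ 5 ≤ ((m + 1 : ℕ) : ℝ) ^ 8 :=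
      pow_le_pow_right₀ (by linarith) (by norm_num)
    have hk1 : (1 : ℝ) ≤ ((m + 1 : ℕ) : ℝ) ^ 5 := one_le_pow₀ (by linarith)
    have hbd : (2 * ((m + 1 : ℕ) : ℝ) ^ 5 * (cn (fun σ => IsManipPointR 3 f σ) +
        cn (fun σ => f σ ≠ G (σ i)))) ≤ 4 * ((m + 1 : ℕ) : ℝ) ^ 5 *
          (α * Fintype.card (Profile n (m + 1))) := by
      calc _ ≤ 2 * ((m + 1 : ℕ) : ℝ) ^ 5 * (α * Fintype.card (Profile n (m + 1)) +
            α * Fintype.card (Profile n (m + 1))) := by gcongr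
        _ = _ := by ring
    obtain ⟨g, hg, hgd⟩ := case_one (by omega) f i G (by
      have h1 : 4 * ((m + 1 : ℕ) : ℝ) ^ 5 * (α * Fintype.card (Profile n (m + 1))) <
          Fintype.card (Profile n (m + 1)) := by
        have h2 : 4 * ((m + 1 : ℕ) : ℝ) ^ 5 * α < 1 := by
          have h3 : 4 * ((m + 1 : ℕ) : ℝ) ^ 5 < C ^ 3 := by linarith
          nlinarith
        calc _ = (4 * ((m + 1 : ℕ) : ℝ) ^ 5 * α) * Fintype.card (Profile n (m + 1)) := by ring
          _ < 1 * Fintype.card (Profile n (m + 1)) := by gcongr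
          _ = _ := one_mul _
      have h4 := lt_of_le_of_lt hbd h1
      exact_mod_cast h4)
    refine ⟨g, hg, hfin g (5 * ((m + 1 : ℕ) : ℝ) ^ 5) (by linarith) ?_⟩
    have hgd' : (cn (fun σ => f σ ≠ g σ) : ℝ) ≤ cn (fun σ => f σ ≠ G (σ i)) +
        2 * ((m + 1 : ℕ) : ℝ) ^ 5 * (cn (fun σ => IsManipPointR 3 f σ) +
        cn (fun σ => f σ ≠ G (σ i))) := by exact_mod_cast hgd
    have hT : 0 ≤ α * Fintype.card (Profile n (m + 1)) := by positivity
    nlinarith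
  · -- two values
    by_cases hab : a = b
    · subst hab
      refine ⟨g0, hconst g0 ⟨a, fun σ => by simpa using hg0 σ⟩, hfin g0 1 (by linarith) ?_⟩
      rw [one_mul]; exact hd0
    have hQ : cn (fun σ => ¬ (f σ = a ∨ f σ = b)) ≤ cn (fun σ => f σ ≠ g0 σ) := by
      apply cn_mono
      intro σ hσ heq
      apply hσ
      rw [heq]
      exact hg0 σ
    obtain ⟨g, hg, hgd⟩ := case_two f a b hab _ le_rfl
    refine ⟨g, hg.elim id (hconst g), hfin g (4 * ((n : ℝ) * ((m + 1 : ℕ) : ℝ) ^ 2) ^ 2) ?_ ?_⟩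
    · refine lt_of_lt_of_le ?_ hCn
      have : (0 : ℝ) < (n : ℝ) ^ 2 * ((m + 1 : ℕ) : ℝ) ^ 4 := by positivity
      nlinarith
    · have hQ' : (cn (fun σ => ¬ (f σ = a ∨ f σ = b)) : ℝ) ≤ cn (fun σ => f σ ≠ g0 σ) := by
        exact_mod_cast hQ
      generalize hA : (cn fun σ => IsManipPointR 3 f σ) +
        (cn fun σ => ¬ (f σ = a ∨ f σ = b)) = A at hgd
      have hA' : (A : ℝ) ≤ 2 * (α * Fintype.card (Profile n (m + 1))) := by
        rw [← hA]; push_cast; linarith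
      have hgd2 : (cn (fun σ => f σ ≠ g σ) : ℝ) ≤
          ((n : ℝ) * ((m + 1 : ℕ) : ℝ) ^ 2 + 2) * A + n * (((m + 1 : ℕ) : ℝ) ^ 2 *
            (A + ((n : ℝ) * ((m + 1 : ℕ) : ℝ) ^ 2 + 2) * A)) := by exact_mod_cast hgd
      have hx : (9 : ℝ) ≤ (n : ℝ) * ((m + 1 : ℕ) : ℝ) ^ 2 := by nlinarith
      exact two_arith _ _ _ _ _ hx (Nat.cast_nonneg _) hgd2 hA'
end

section
/- Let n ≥ 2, k ≥ 3, and 0 < ε ≤ 1. If f : S_k^n → [k] is an SCF with D(f, NONMANIP-bar) ≥ ε, then P(σ ∈ M(f)) ≥ ε^5 / (4 · n^7 · k^12 · (k!)^4), where σ is uniform on S_k^n. -/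
open Finset

namespace QGS

/-! ### Rankings from scores -/

lemma exists_perm_of_score {k : ℕ} (s : Fin k → ℕ) (hs : Function.Injective s) :
    ∃ x : Equiv.Perm (Fin k), ∀ a b, Above x a b ↔ s a < s b := by
  refine ⟨Tuple.sort s, fun a b => ?_⟩
  have hm : StrictMono (s ∘ Tuple.sort s) :=
    (Tuple.monotone_sort s).strictMono_of_injective (hs.comp (Tuple.sort s).injective)
  have := hm.lt_iff_lt (a := (Tuple.sort s).symm a) (b := (Tuple.sort s).symm b)
  simp only [Function.comp, Equiv.apply_symm_apply] at this
  exact this.symm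

lemma above_ne {k : ℕ} {x : Equiv.Perm (Fin k)} {a b : Fin k} (h : Above x a b) : a ≠ b := by
  rintro rfl
  exact lt_irrefl _ h

lemma above_asymm {k : ℕ} {x : Equiv.Perm (Fin k)} {a b : Fin k} (h : Above x a b) :
    ¬ Above x b a := lt_asymm h

lemma above_of_not {k : ℕ} {x : Equiv.Perm (Fin k)} {a b : Fin k} (hab : a ≠ b)
    (h : ¬ Above x b a) : Above x a b :=
  lt_of_le_of_ne (not_lt.mp h) (fun e => hab (x.symm.injective e))

/-- a ranking with prescribed first and second alternatives -/
lemma exists_top_two {k : ℕ} {c b : Fin k} (hcb : c ≠ b) :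
    ∃ x : Equiv.Perm (Fin k), (∀ d, d ≠ c → Above x c d) ∧
      (∀ d, d ≠ c → d ≠ b → Above x b d) := by
  obtain ⟨x, hx⟩ := exists_perm_of_score
    (fun d : Fin k => if d = c then 0 else if d = b then 1 else (d : ℕ) + 2) (by
      intro d e h
      simp only at h
      split_ifs at h <;> (apply Fin.ext; omega))
  refine ⟨x, fun d hd => ?_, fun d hd hd' => ?_⟩
  · rw [hx]; simp [hd]; split_ifs <;> omega
  · rw [hx]; simp [hd, hd', hcb.symm]

/-- move `a` to the top of `y` -/
lemma exists_move_top {k : ℕ} (y : Equiv.Perm (Fin k)) (a : Fin k) :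
    ∃ x : Equiv.Perm (Fin k), (∀ d, d ≠ a → Above x a d) ∧
      (∀ d e, d ≠ a → e ≠ a → (Above x d e ↔ Above y d e)) := by
  obtain ⟨x, hx⟩ := exists_perm_of_score
    (fun d : Fin k => if d = a then 0 else (y.symm d : ℕ) + 1) (by
      intro d e h
      simp only at h
      split_ifs at h
      · subst_vars; rfl
      · have h' : y.symm d = y.symm e := Fin.ext (by omega)
        exact y.symm.injective h')
  refine ⟨x, fun d hd => ?_, fun d e hd he => ?_⟩
  · rw [hx]; simp [hd]
  · rw [hx]; simp [hd, he, Above]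

/-! ### Two voters -/

section plane
variable {k : ℕ} {g : Equiv.Perm (Fin k) → Equiv.Perm (Fin k) → Fin k}

/-- `c` is in the menu offered by `y` to the first voter -/
def Menu (g : Equiv.Perm (Fin k) → Equiv.Perm (Fin k) → Fin k) (y : Equiv.Perm (Fin k))
    (c : Fin k) : Prop := ∃ x, g x y = c

lemma menu_key (h1 : ∀ x x' y, ¬ Above x (g x' y) (g x y))
    (h2 : ∀ x y y', ¬ Above y (g x y') (g x y)) {y y' : Equiv.Perm (Fin k)} {b c : Fin k}
    (hc : Menu g y' c) (hc' : ¬ Menu g y c) (hb : Menu g y b) :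
    Above y b c ∧ Above y' c b := by
  have hcb : c ≠ b := by rintro rfl; exact hc' hb
  obtain ⟨x, hx1, hx2⟩ := exists_top_two hcb
  obtain ⟨xc, rfl⟩ := hc
  obtain ⟨xb, rfl⟩ := hb
  have e1 : g x y' = g xc y' := by
    by_contra hne
    exact h1 x xc y' (hx1 _ hne)
  have e2 : g x y = g xb y := by
    by_contra hne
    by_cases h : g x y = g xc y'
    · exact hc' ⟨x, h⟩
    · exact h1 x xb y (hx2 _ h hne)
  have k1 := h2 x y y'
  have k2 := h2 x y' y
  rw [e1, e2] at k1 k2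
  exact ⟨above_of_not hcb.symm k1, above_of_not hcb k2⟩

lemma menu_sub (h1 : ∀ x x' y, ¬ Above x (g x' y) (g x y))
    (h2 : ∀ x y y', ¬ Above y (g x y') (g x y)) {y0 : Equiv.Perm (Fin k)} {a b : Fin k}
    (hab : a ≠ b) (ha : Menu g y0 a) (hb : Menu g y0 b) (y : Equiv.Perm (Fin k)) {c : Fin k}
    (hc : Menu g y c) : Menu g y0 c := by
  by_contra hc'
  have main : ∀ a b, a ≠ b → Menu g y0 a → Menu g y0 b → Above y0 b a := by
    intro a b hab ha hb
    obtain ⟨y2, ht, ho⟩ := exists_move_top y a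
    have hca : c ≠ a := by rintro rfl; exact hc' ha
    have hcb : c ≠ b := by rintro rfl; exact hc' hb
    have hsub : ∀ e, Menu g y2 e → Menu g y0 e := by
      intro e he
      by_contra he'
      have hk := (menu_key h1 h2 he he' ha).2
      exact above_asymm hk (ht e (above_ne hk))
    have ha2 : Menu g y2 a := by
      by_contra ha2
      have he : Menu g y2 (g 1 y2) := ⟨1, rfl⟩
      have hk := (menu_key h1 h2 ha ha2 he).1
      exact above_asymm hk (ht _ (above_ne hk))
    have hb2 : ¬ Menu g y2 b := by
      intro hb2
      have hc2 : ¬ Menu g y2 c := fun h => hc' (hsub c h)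
      have hk := (menu_key h1 h2 hc hc2 hb2).1
      have hk' := (menu_key h1 h2 hc hc' hb).2
      rw [ho b c hab.symm hca] at hk
      exact above_asymm hk hk'
    exact (menu_key h1 h2 hb hb2 ha2).2
  exact above_asymm (main a b hab ha hb) (main b a hab.symm hb ha)

/-- menu of size at least three: the first voter dictates -/
lemma menu_three (h1 : ∀ x x' y, ¬ Above x (g x' y) (g x y))
    (h2 : ∀ x y y', ¬ Above y (g x y') (g x y)) {y0 : Equiv.Perm (Fin k)} {a b c : Fin k}
    (hab : a ≠ b) (hac : a ≠ c) (hbc : b ≠ c)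
    (ha : Menu g y0 a) (hb : Menu g y0 b) (hc : Menu g y0 c) (y : Equiv.Perm (Fin k)) {d : Fin k}
    (hd : Menu g y0 d) : Menu g y d := by
  by_contra hd'
  have he : Menu g y (g 1 y) := ⟨1, rfl⟩
  set e := g 1 y with hedef
  have huniq : ∀ e', Menu g y e' → e' = e := by
    intro e' he'
    by_contra hne
    exact hd' (menu_sub h1 h2 hne he' he y0 hd)
  have he0 : Menu g y0 e := menu_sub h1 h2 hab ha hb y he
  have hbot : ∀ p, Menu g y0 p → p ≠ e → Above y0 p e := by
    intro p hp hpe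
    exact (menu_key h1 h2 hp (fun h => hpe (huniq p h)) he).2
  obtain ⟨p, q, hpq, hpe, hqe, hp, hq⟩ : ∃ p q, p ≠ q ∧ p ≠ e ∧ q ≠ e ∧ Menu g y0 p ∧
      Menu g y0 q := by
    by_cases h : a = e
    · exact ⟨b, c, hbc, fun h' => hab (h.trans h'.symm), fun h' => hac (h.trans h'.symm), hb, hc⟩
    · by_cases h' : b = e
      · exact ⟨a, c, hac, h, fun h'' => hbc (h'.trans h''.symm), ha, hc⟩
      · exact ⟨a, b, hab, h, h', ha, hb⟩
  obtain ⟨y1, ht, ho⟩ := exists_top_two hpe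
  have hfull : ∀ r, Menu g y0 r → Menu g y1 r := by
    intro r hr
    by_contra hr'
    have hs : Menu g y1 (g 1 y1) := ⟨1, rfl⟩
    set s := g 1 y1
    have hs0 : Menu g y0 s := menu_sub h1 h2 hab ha hb y1 hs
    have huniq' : ∀ e', Menu g y1 e' → e' = s := by
      intro e' he'
      by_contra hne
      exact hr' (menu_sub h1 h2 hne he' hs y0 hr)
    have hse : s = e := by
      by_contra hne
      have := hbot s hs0 hne
      have h3 := (menu_key h1 h2 he0 (fun h => hne (huniq' e h).symm) hs).2
      exact above_asymm this h3
    have hp1 : ¬ Menu g y1 p := fun h => hpe ((huniq' p h).trans hse)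
    have hk := (menu_key h1 h2 hp hp1 hs).1
    rw [hse] at hk
    exact above_asymm hk (ht e hpe.symm)
  have hq' : ¬ Menu g y q := fun h => hqe (huniq q h)
  have hk := (menu_key h1 h2 (hfull q hq) hq' he).2
  exact above_asymm hk (ho q hpq.symm hqe)

/-- menu of size two is preserved by changes of the other voter which preserve the
relative order of the two alternatives -/
lemma menu_two (h1 : ∀ x x' y, ¬ Above x (g x' y) (g x y))
    (h2 : ∀ x y y', ¬ Above y (g x y') (g x y)) {y0 y : Equiv.Perm (Fin k)} {a b : Fin k}
    (hab : a ≠ b) (hm : ∀ c, Menu g y0 c ↔ c = a ∨ c = b)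
    (hy : Above y a b ↔ Above y0 a b) (c : Fin k) : Menu g y c ↔ c = a ∨ c = b := by
  have ha : Menu g y0 a := (hm a).2 (Or.inl rfl)
  have hb : Menu g y0 b := (hm b).2 (Or.inr rfl)
  have he : Menu g y (g 1 y) := ⟨1, rfl⟩
  have hsub : ∀ c, Menu g y c → c = a ∨ c = b :=
    fun c hc => (hm c).1 (menu_sub h1 h2 hab ha hb y hc)
  have hay : Menu g y a := by
    by_contra hay
    have hby : Menu g y b := by
      rcases hsub _ he with h | h
      · rw [h] at he; exact absurd he hay
      · rwa [h] at he
    have hk := menu_key h1 h2 ha hay hby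
    exact above_asymm (hy.2 hk.2) hk.1
  have hby : Menu g y b := by
    by_contra hby
    have hk := menu_key h1 h2 hb hby hay
    exact above_asymm (hy.1 hk.1) hk.2
  exact ⟨hsub c, by rintro (rfl | rfl) <;> assumption⟩

end plane

/-! ### The range along a line -/

section lines
variable {n k : ℕ}

open Classical in
/-- the set of values of `f` on the line in direction `i` through `σ` -/
noncomputable def R (f : Profile n k → Fin k) (i : Fin n) (σ : Profile n k) : Finset (Fin k) :=
  Finset.univ.image (fun τ => f (Function.update σ i τ))

/-- some point of the `(i,j)`-plane through `σ` is a manipulation point -/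
def Bad (f : Profile n k → Fin k) (i j : Fin n) (σ : Profile n k) : Prop :=
  ∃ x y, IsManipPoint f (Function.update (Function.update σ i x) j y)

lemma mem_R {f : Profile n k → Fin k} {i : Fin n} {σ : Profile n k} {c : Fin k} :
    c ∈ R f i σ ↔ ∃ τ, f (Function.update σ i τ) = c := by
  simp [R]

lemma self_mem_R (f : Profile n k → Fin k) (i : Fin n) (σ : Profile n k) : f σ ∈ R f i σ :=
  mem_R.2 ⟨σ i, by simp⟩

lemma R_update (f : Profile n k → Fin k) (i : Fin n) (σ : Profile n k) (τ) :
    R f i (Function.update σ i τ) = R f i σ := by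
  ext c; simp [mem_R]

lemma manip_of_above {f : Profile n k → Fin k} {σ : Profile n k} {i : Fin n} {τ}
    (h : Above (σ i) (f (Function.update σ i τ)) (f σ)) : IsManipPoint f σ := by
  refine ⟨Function.update σ i τ, i, ?_, ?_, h⟩
  · intro e
    simp only [Function.update_self] at e
    rw [← e, Function.update_eq_self] at h
    exact above_ne h rfl
  · intro j hj
    simp [hj]

/-- the restriction to the plane -/
def pl (f : Profile n k → Fin k) (i j : Fin n) (σ : Profile n k) :
    Equiv.Perm (Fin k) → Equiv.Perm (Fin k) → Fin k :=
  fun x y => f (Function.update (Function.update σ i x) j y)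

lemma pl_h1 {f : Profile n k → Fin k} {i j : Fin n} (hij : i ≠ j) {σ : Profile n k}
    (hb : ¬ Bad f i j σ) : ∀ x x' y, ¬ Above x (pl f i j σ x' y) (pl f i j σ x y) := by
  intro x x' y h
  refine hb ⟨x, y, manip_of_above (i := i) (τ := x') ?_⟩
  have e : Function.update (Function.update (Function.update σ i x) j y) i x' =
      Function.update (Function.update σ i x') j y := by
    rw [Function.update_comm hij.symm, Function.update_idem]
  rw [e]
  simpa [hij, pl] using h

lemma pl_h2 {f : Profile n k → Fin k} {i j : Fin n} {σ : Profile n k}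
    (hb : ¬ Bad f i j σ) : ∀ x y y', ¬ Above y (pl f i j σ x y') (pl f i j σ x y) := by
  intro x y y' h
  refine hb ⟨x, y, manip_of_above (i := j) (τ := y') ?_⟩
  simpa [pl] using h

lemma mem_R_update {f : Profile n k → Fin k} {i j : Fin n} (hij : i ≠ j) {σ : Profile n k}
    {y c} : c ∈ R f i (Function.update σ j y) ↔ Menu (pl f i j σ) y c := by
  simp only [mem_R, Menu, pl]
  simp_rw [Function.update_comm hij]

lemma mem_R_iff {f : Profile n k → Fin k} {i j : Fin n} (hij : i ≠ j) {σ : Profile n k}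
    {c} : c ∈ R f i σ ↔ Menu (pl f i j σ) (σ j) c := by
  rw [← mem_R_update hij, Function.update_eq_self]

lemma R_sub {f : Profile n k → Fin k} {i j : Fin n} (hij : i ≠ j) {σ : Profile n k}
    (hb : ¬ Bad f i j σ) (hR : 2 ≤ (R f i σ).card) : R f j σ ⊆ R f i σ := by
  obtain ⟨a, ha, b, hb', hab⟩ := Finset.one_lt_card.1 hR
  intro c hc
  obtain ⟨y, rfl⟩ := mem_R.1 hc
  rw [mem_R_iff hij] at *
  refine menu_sub (pl_h1 hij hb) (pl_h2 hb) hab ha hb' y ?_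
  exact ⟨σ i, by simp [pl]⟩

lemma line_three {f : Profile n k → Fin k} {i j : Fin n} (hij : i ≠ j) {σ : Profile n k}
    (hb : ¬ Bad f i j σ) (hR : 3 ≤ (R f i σ).card) (y x) :
    f (Function.update (Function.update σ j y) i x) = f (Function.update σ i x) := by
  obtain ⟨a, ha, b, hb', c, hc, hab, hac, hbc⟩ := Finset.two_lt_card.1 hR
  rw [mem_R_iff hij] at ha hb' hc
  have hh1 := pl_h1 hij hb
  have hh2 := pl_h2 hb
  have e1 : f (Function.update (Function.update σ j y) i x) = pl f i j σ x y := by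
    rw [Function.update_comm hij.symm]; rfl
  have e2 : f (Function.update σ i x) = pl f i j σ x (σ j) := by
    simp [pl, Function.update_comm hij]
  rw [e1, e2]
  by_contra hne
  obtain ⟨x1, hx1⟩ := menu_three hh1 hh2 hab hac hbc ha hb' hc y (d := pl f i j σ x (σ j)) ⟨x, rfl⟩
  obtain ⟨x2, hx2⟩ := menu_sub hh1 hh2 hab ha hb' y (c := pl f i j σ x y) ⟨x, rfl⟩
  have k1 := hh1 x x1 y
  have k2 := hh1 x x2 (σ j)
  rw [hx1] at k1
  rw [hx2] at k2
  exact k2 (above_of_not hne k1)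

lemma line_two {f : Profile n k → Fin k} {i j : Fin n} (hij : i ≠ j) {σ : Profile n k}
    (hb : ¬ Bad f i j σ) {a b : Fin k} (hab : a ≠ b) (hR : R f i σ = {a, b}) {y}
    (hy : Above y a b ↔ Above (σ j) a b) : R f i (Function.update σ j y) = {a, b} := by
  ext c
  rw [mem_R_update hij, menu_two (pl_h1 hij hb) (pl_h2 hb) hab (fun c => ?_) hy c]
  · simp
  · rw [← mem_R_iff hij, hR]; simp

lemma bad_update {f : Profile n k → Fin k} {i j : Fin n} {σ : Profile n k} {y}
    (h : Bad f i j (Function.update σ j y)) (hij : i ≠ j) : Bad f i j σ := by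
  obtain ⟨x, z, h⟩ := h
  refine ⟨x, z, ?_⟩
  rwa [Function.update_comm hij.symm, Function.update_idem] at h

end lines

/-! ### Counting -/

section counting
open Classical in
lemma count_def {α : Type*} [Fintype α] (p : α → Prop) :
    count p = ∑ a, if p a then (1 : ℝ) else 0 := by
  unfold count
  rw [Finset.card_filter]
  push_cast
  rfl

lemma prob_def {α : Type*} [Fintype α] (p : α → Prop) :
    prob p = count p / (Fintype.card α : ℝ) := rfl

lemma count_nonneg {α : Type*} [Fintype α] (p : α → Prop) : 0 ≤ count p := by
  unfold count; positivity

lemma count_mono {α : Type*} [Fintype α] {p q : α → Prop} (h : ∀ a, p a → q a) :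
    count p ≤ count q := by
  rw [count_def, count_def]
  refine Finset.sum_le_sum fun a _ => ?_
  by_cases hp : p a
  · simp [hp, h a hp]
  · simp only [hp, if_false]; split_ifs <;> norm_num

lemma count_congr {α : Type*} [Fintype α] {p q : α → Prop} (h : ∀ a, p a ↔ q a) :
    count p = count q :=
  le_antisymm (count_mono fun a => (h a).1) (count_mono fun a => (h a).2)

lemma count_or_le {α : Type*} [Fintype α] (p q : α → Prop) :
    count (fun a => p a ∨ q a) ≤ count p + count q := by
  rw [count_def, count_def, count_def, ← Finset.sum_add_distrib]
  refine Finset.sum_le_sum fun a _ => ?_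
  by_cases hp : p a <;> by_cases hq : q a <;> simp [hp, hq]

lemma count_true {α : Type*} [Fintype α] : count (fun _ : α => True) = Fintype.card α := by
  rw [count_def]; simp

lemma count_le_card {α : Type*} [Fintype α] (p : α → Prop) : count p ≤ Fintype.card α := by
  rw [← count_true]; exact count_mono fun _ _ => trivial

lemma count_not {α : Type*} [Fintype α] (p : α → Prop) :
    count (fun a => ¬ p a) = Fintype.card α - count p := by
  rw [← count_true, count_def, count_def, count_def, ← Finset.sum_sub_distrib]
  refine Finset.sum_congr rfl fun a _ => ?_
  by_cases hp : p a <;> simp [hp]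

lemma count_and_add {α : Type*} [Fintype α] (p q : α → Prop) :
    count (fun a => p a ∧ q a) + count (fun a => p a ∧ ¬ q a) = count p := by
  rw [count_def, count_def, count_def, ← Finset.sum_add_distrib]
  refine Finset.sum_congr rfl fun a _ => ?_
  by_cases hp : p a <;> by_cases hq : q a <;> simp [hp, hq]

lemma count_false {α : Type*} [Fintype α] {p : α → Prop} (h : ∀ a, ¬ p a) : count p = 0 := by
  rw [count_def]; simp [h]

lemma count_equiv {α β : Type*} [Fintype α] [Fintype β] (e : α ≃ β) (p : β → Prop) :
    count (fun a => p (e a)) = count p := by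
  rw [count_def, count_def]
  exact Fintype.sum_equiv e _ _ fun _ => rfl

lemma count_prod {α β : Type*} [Fintype α] [Fintype β] (p : α × β → Prop) :
    count p = ∑ a, count (fun b => p (a, b)) := by
  rw [count_def, Fintype.sum_prod_type]
  exact Finset.sum_congr rfl fun a _ => (count_def _).symm

lemma count_exists_le {α ι : Type*} [Fintype α] (J : Finset ι) (p : ι → α → Prop) :
    count (fun a => ∃ i ∈ J, p i a) ≤ ∑ i ∈ J, count (p i) := by
  classical
  induction J using Finset.induction_on with
  | empty => rw [count_false] <;> simp
  | insert i J hi ih =>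
    rw [Finset.sum_insert hi]
    refine le_trans (count_mono (q := fun a => p i a ∨ ∃ i ∈ J, p i a) fun a => ?_)
      (le_trans (count_or_le _ _) (by linarith))
    simp

/-- lower bound for a sum over a set -/
lemma count_mul_le_sum {α : Type*} [Fintype α] (p : α → Prop) (F : α → ℝ) (c : ℝ)
    (h0 : ∀ a, 0 ≤ F a) (h : ∀ a, p a → c ≤ F a) : count p * c ≤ ∑ a, F a := by
  rw [count_def, Finset.sum_mul]
  refine Finset.sum_le_sum fun a _ => ?_
  by_cases hp : p a
  · simpa [hp] using h a hp
  · simpa [hp] using h0 a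

lemma count_pi {X : Type*} [Fintype X] {n : ℕ} (p : Fin n → X → Prop) :
    count (fun σ : Fin n → X => ∀ j, p j (σ j)) = ∏ j, count (p j) := by
  classical
  unfold count
  rw [← Nat.cast_prod, ← Fintype.card_piFinset]
  congr 2
  ext σ
  simp [Fintype.mem_piFinset]

end counting

/-! ### The hybrid argument -/

section hybrid
variable {X L β : Type*} {n : ℕ}

/-- same labels -/
def Sim (u : X → L) (σ σ' : Fin n → X) : Prop := ∀ j, u (σ' j) = u (σ j)

lemma count_sim [Fintype X] (u : X → L) {c : ℝ} (hc : ∀ x, count (fun y => u y = u x) = c)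
    (σ : Fin n → X) : count (fun σ' => Sim u σ σ') = c ^ n := by
  unfold Sim
  rw [count_pi (fun j y => u y = u (σ j))]
  simp [hc]

/-- exchange the coordinates in `J` -/
def swapEquiv (X : Type*) {n : ℕ} (J : Finset (Fin n)) :
    (Fin n → X) × (Fin n → X) ≃ (Fin n → X) × (Fin n → X) where
  toFun p := (J.piecewise p.2 p.1, J.piecewise p.1 p.2)
  invFun p := (J.piecewise p.2 p.1, J.piecewise p.1 p.2)
  left_inv p := by
    ext j <;> by_cases h : j ∈ J <;> simp [h]
  right_inv p := by
    ext j <;> by_cases h : j ∈ J <;> simp [h]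

lemma sim_swap (u : X → L) (J : Finset (Fin n)) (p : (Fin n → X) × (Fin n → X)) :
    Sim u (swapEquiv X J p).1 (swapEquiv X J p).2 ↔ Sim u p.1 p.2 := by
  unfold Sim swapEquiv
  refine forall_congr' fun j => ?_
  by_cases h : j ∈ J <;> simp [h, eq_comm]

/-- `h` is not constant on the `j`-line through `σ`, restricted to the label of `σ j` -/
def Bd (u : X → L) (h : (Fin n → X) → β) (j : Fin n) (σ : Fin n → X) : Prop :=
  ∃ τ, u τ = u (σ j) ∧ h (Function.update σ j τ) ≠ h σ

lemma hybrid [Fintype X] (u : X → L) {c : ℝ} (hc : ∀ x, count (fun y => u y = u x) = c)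
    (h : (Fin n → X) → β) (J : Finset (Fin n)) :
    count (fun p : (Fin n → X) × (Fin n → X) =>
      Sim u p.1 p.2 ∧ h p.1 ≠ h (J.piecewise p.2 p.1)) ≤ c ^ n * ∑ j ∈ J, count (Bd u h j) := by
  induction J using Finset.induction_on with
  | empty => rw [count_false] <;> simp
  | insert j J hj ih =>
    rw [Finset.sum_insert hj, mul_add]
    have step : count (fun p : (Fin n → X) × (Fin n → X) =>
        Sim u p.1 p.2 ∧ Bd u h j (J.piecewise p.2 p.1)) = c ^ n * count (Bd u h j) := by
      have := count_equiv (swapEquiv X J) (fun p => Sim u p.1 p.2 ∧ Bd u h j p.1)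
      simp only [sim_swap] at this
      refine Eq.trans this ?_
      rw [count_prod, count_def, Finset.mul_sum]
      refine Finset.sum_congr rfl fun σ _ => ?_
      by_cases hb : Bd u h j σ
      · simp [hb, count_sim u hc]
      · simp [hb, count_false]
    rw [← step]
    refine le_trans (count_mono (q := fun p => (Sim u p.1 p.2 ∧ Bd u h j (J.piecewise p.2 p.1)) ∨
      (Sim u p.1 p.2 ∧ h p.1 ≠ h (J.piecewise p.2 p.1))) ?_)
      (le_trans (count_or_le _ _) (by linarith))
    rintro ⟨σ, σ'⟩ ⟨hs, hne⟩
    simp only at hs hne ⊢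
    by_cases he : h σ = h (J.piecewise σ' σ)
    · left
      refine ⟨hs, σ' j, ?_, ?_⟩
      · rw [hs j]; simp [hj]
      · rw [he, Finset.piecewise_insert] at hne
        exact hne.symm
    · exact Or.inr ⟨hs, he⟩

/-- all pairs -/
lemma hybrid_all [Fintype X] (h : (Fin n → X) → β) (J : Finset (Fin n)) :
    ∑ σ, count (fun σ' : Fin n → X => h σ ≠ h (J.piecewise σ' σ)) ≤
      (Fintype.card X : ℝ) ^ n * ∑ j ∈ J, count (Bd (fun _ : X => ()) h j) := by
  have := hybrid (fun _ : X => ()) (c := Fintype.card X)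
    (fun x => by rw [← count_true]; exact count_congr (by simp)) h J
  rw [count_prod] at this
  simpa [Sim] using this

/-- sets almost closed under label-preserving moves are close to label-determined sets -/
lemma exists_label_set [Fintype X] (u : X → L) {c : ℝ} (hcpos : 0 < c)
    (hc : ∀ x, count (fun y => u y = u x) = c) (A : (Fin n → X) → Prop) :
    ∃ T : (Fin n → L) → Prop,
      count (fun σ => (A σ ∧ ¬ T (u ∘ σ)) ∨ (¬ A σ ∧ T (u ∘ σ))) ≤
        2 * ∑ j, count (Bd u A j) := by
  have hyb := hybrid u hc A Finset.univ
  simp only [Finset.piecewise_univ] at hyb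
  set B := ∑ j, count (Bd u A j)
  have hcn : 0 < c ^ n := by positivity
  let T : (Fin n → L) → Prop := fun z => c ^ n ≤ 2 * count (fun σ' => u ∘ σ' = z ∧ A σ')
  refine ⟨T, ?_⟩
  have hsim : ∀ σ σ' : Fin n → X, u ∘ σ' = u ∘ σ ↔ Sim u σ σ' := fun σ σ' => funext_iff
  have key : count (fun σ => (A σ ∧ ¬ T (u ∘ σ)) ∨ (¬ A σ ∧ T (u ∘ σ))) * (c ^ n / 2) ≤
      c ^ n * B := by
    rw [count_prod] at hyb
    refine le_trans (count_mul_le_sum _ _ _ (fun _ => count_nonneg _) ?_) hyb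
    rintro σ (⟨hA, hT⟩ | ⟨hA, hT⟩)
    · have h1 := count_and_add (fun σ' => Sim u σ σ') A
      rw [count_sim u hc] at h1
      have h2 : count (fun σ' => u ∘ σ' = u ∘ σ ∧ A σ') = count (fun σ' => Sim u σ σ' ∧ A σ') :=
        count_congr fun σ' => by rw [hsim]
      have h3 : count (fun σ' => Sim u σ σ' ∧ A σ ≠ A σ') =
          count (fun σ' => Sim u σ σ' ∧ ¬ A σ') := count_congr fun σ' => by simp [hA]
      simp only [T, not_le, h2] at hT
      simp only [h3]
      linarith
    · have h2 : count (fun σ' => u ∘ σ' = u ∘ σ ∧ A σ') = count (fun σ' => Sim u σ σ' ∧ A σ') :=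
        count_congr fun σ' => by rw [hsim]
      have h3 : count (fun σ' => Sim u σ σ' ∧ A σ ≠ A σ') =
          count (fun σ' => Sim u σ σ' ∧ A σ') := count_congr fun σ' => by simp [hA]
      simp only [T, h2] at hT
      simp only [h3]
      linarith
  have : count (fun σ => (A σ ∧ ¬ T (u ∘ σ)) ∨ (¬ A σ ∧ T (u ∘ σ))) * (c ^ n) ≤
      (2 * B) * c ^ n := by linarith
  exact le_of_mul_le_mul_right this hcn

end hybrid

/-! ### Correlated label sets intersect -/

section corr
variable {X L : Type*} [Fintype X]

/-- one-coordinate inequality -/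
def CorrIneq (u v : X → L) : Prop :=
  ∀ t s : L → ℝ, (∀ l, 0 ≤ t l) → (∀ l, 0 ≤ s l) →
    ((∑ x, t (u x)) * (∑ x, s (v x))) ^ 2 ≤
      (Fintype.card X : ℝ) ^ 3 * ∑ x, (t (u x) * s (v x)) ^ 2

lemma count_cons {n : ℕ} (p : (Fin (n + 1) → X) → Prop) :
    count p = ∑ x, count (fun σ : Fin n → X => p (Fin.cons x σ)) := by
  rw [← count_equiv (Fin.consEquiv (fun _ : Fin (n + 1) => X)) p, count_prod]
  rfl

lemma comp_cons {X L : Type*} {n : ℕ} (u : X → L) (x : X) (σ : Fin n → X) :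
    u ∘ (Fin.cons x σ : Fin (n + 1) → X) = Fin.cons (u x) (u ∘ σ) := by
  funext j
  refine Fin.cases ?_ (fun j => ?_) j <;> simp

lemma corr_main [Nonempty X] (u v : X → L) (huv : CorrIneq u v) (n : ℕ)
    (T S : (Fin n → L) → Prop) :
    (count (fun σ : Fin n → X => T (u ∘ σ)) * count (fun σ : Fin n → X => S (v ∘ σ))) ^ 2 ≤
      ((Fintype.card X : ℝ) ^ n) ^ 3 * count (fun σ : Fin n → X => T (u ∘ σ) ∧ S (v ∘ σ)) := by
  induction n with
  | zero =>
    have e : ∀ (w : X → L) (σ : Fin 0 → X), w ∘ σ = Fin.elim0 := fun w σ => Subsingleton.elim _ _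
    rw [count_congr (p := fun σ : Fin 0 → X => T (u ∘ σ)) (q := fun _ => T Fin.elim0)
        (fun σ => by rw [e u]),
      count_congr (p := fun σ : Fin 0 → X => S (v ∘ σ)) (q := fun _ => S Fin.elim0)
        (fun σ => by rw [e v]),
      count_congr (p := fun σ : Fin 0 → X => T (u ∘ σ) ∧ S (v ∘ σ))
        (q := fun _ => T Fin.elim0 ∧ S Fin.elim0) (fun σ => by rw [e u, e v])]
    simp only [count_def]
    by_cases hT : T Fin.elim0 <;> by_cases hS : S Fin.elim0 <;> simp [hT, hS]
  | succ n ih =>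
    rw [count_cons, count_cons, count_cons (fun σ => T (u ∘ σ) ∧ S (v ∘ σ))]
    simp only [comp_cons]
    let t : L → ℝ := fun l => count (fun σ : Fin n → X => T (Fin.cons l (u ∘ σ)))
    let s : L → ℝ := fun l => count (fun σ : Fin n → X => S (Fin.cons l (v ∘ σ)))
    refine le_trans (huv t s (fun _ => count_nonneg _) (fun _ => count_nonneg _)) ?_
    have hstep : ∑ x, (t (u x) * s (v x)) ^ 2 ≤ ∑ x, ((Fintype.card X : ℝ) ^ n) ^ 3 *
        count (fun σ : Fin n → X => T (Fin.cons (u x) (u ∘ σ)) ∧ S (Fin.cons (v x) (v ∘ σ))) :=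
      Finset.sum_le_sum fun x _ => ih (fun z => T (Fin.cons (u x) z)) (fun z => S (Fin.cons (v x) z))
    rw [← Finset.mul_sum] at hstep
    calc _ ≤ (Fintype.card X : ℝ) ^ 3 * _ := mul_le_mul_of_nonneg_left hstep (by positivity)
      _ = _ := by ring

lemma sum_bool_fiber (u v : X → Bool) (F : Bool → Bool → ℝ) :
    ∑ x, F (u x) (v x) =
      count (fun x => u x = true ∧ v x = true) * F true true +
      count (fun x => u x = true ∧ v x = false) * F true false +
      count (fun x => u x = false ∧ v x = true) * F false true +
      count (fun x => u x = false ∧ v x = false) * F false false := by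
  simp only [count_def, Finset.sum_mul, ← Finset.sum_add_distrib]
  refine Finset.sum_congr rfl fun x _ => ?_
  cases u x <;> cases v x <;> simp

lemma corr_of_counts (u v : X → Bool)
    (h1 : count (fun x => u x = true ∧ v x = true) = count (fun x => u x = false ∧ v x = false))
    (h2 : count (fun x => u x = true ∧ v x = false) = count (fun x => u x = false ∧ v x = true))
    (h3 : count (fun x => u x = true ∧ v x = true) ≤
      3 * count (fun x => u x = true ∧ v x = false))
    (h4 : count (fun x => u x = true ∧ v x = false) ≤
      3 * count (fun x => u x = true ∧ v x = true)) : CorrIneq u v := by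
  intro t s ht hs
  have e1 := sum_bool_fiber u v (fun p _ => t p)
  have e2 := sum_bool_fiber u v (fun _ q => s q)
  have e3 := sum_bool_fiber u v (fun p q => (t p * s q) ^ 2)
  have e4 := sum_bool_fiber u v (fun _ _ => 1)
  rw [e1, e2, e3]
  simp only [Finset.sum_const, Finset.card_univ, nsmul_eq_mul, mul_one] at e4
  rw [e4, ← h1, ← h2]
  set A := count (fun x => u x = true ∧ v x = true)
  set B := count (fun x => u x = true ∧ v x = false)
  have hA : 0 ≤ A := count_nonneg _
  have hB : 0 ≤ B := count_nonneg _
  set a := t true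
  set b := t false
  set c := s true
  set d := s false
  have key : (A + B) * ((a + b) * (c + d)) ^ 2 ≤
      8 * (A * (a * c) ^ 2 + B * (a * d) ^ 2 + B * (b * c) ^ 2 + A * (b * d) ^ 2) := by
    have hV : 0 ≤ 3 * A - B := by linarith
    have hU : 0 ≤ 3 * B - A := by linarith
    have q1 := mul_nonneg hV (sq_nonneg (a * c - b * d))
    have q2 := mul_nonneg hU (sq_nonneg (b * c - a * d))
    have q3 := mul_nonneg (add_nonneg hA hB) (sq_nonneg ((a - b) * (c - d)))
    linarith
  have hAB : 0 ≤ (A + B) ^ 3 := by positivity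
  nlinarith [mul_le_mul_of_nonneg_left key hAB]

end corr

/-! ### Labels of rankings -/

section labels
variable {k : ℕ}

open Classical in
/-- does the ranking prefer `a` to `b`? -/
noncomputable def lab (a b : Fin k) (x : Equiv.Perm (Fin k)) : Bool := decide (Above x a b)

lemma lab_true {a b : Fin k} {x : Equiv.Perm (Fin k)} : lab a b x = true ↔ Above x a b := by
  simp [lab]

lemma lab_false {a b : Fin k} (hab : a ≠ b) {x : Equiv.Perm (Fin k)} :
    lab a b x = false ↔ Above x b a := by
  simp only [lab, decide_eq_false_iff_not]
  exact ⟨fun h => above_of_not hab.symm h, fun h => above_asymm h⟩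

lemma above_mul (p x : Equiv.Perm (Fin k)) (a b : Fin k) :
    Above (p * x) (p a) (p b) ↔ Above x a b := by
  unfold Above
  have h : ∀ c, (p * x).symm (p c) = x.symm c := by
    intro c
    rw [Equiv.symm_apply_eq]; simp
  rw [h, h]

lemma above_rev (x : Equiv.Perm (Fin k)) (a b : Fin k) :
    Above (x * Fin.revPerm) a b ↔ Above x b a := by
  unfold Above
  have h : ∀ c, (x * Fin.revPerm).symm c = Fin.rev (x.symm c) := by
    intro c
    rw [Equiv.symm_apply_eq]; simp
  rw [h, h, Fin.rev_lt_rev]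

lemma count_relabel (p : Equiv.Perm (Fin k)) (a b c d : Fin k) :
    count (fun x : Equiv.Perm (Fin k) => Above x a b ∧ Above x c d) =
      count (fun x : Equiv.Perm (Fin k) => Above x (p a) (p b) ∧ Above x (p c) (p d)) := by
  rw [← count_equiv (Equiv.mulLeft p)
    (fun x : Equiv.Perm (Fin k) => Above x (p a) (p b) ∧ Above x (p c) (p d))]
  simp only [Equiv.coe_mulLeft, above_mul]

lemma count_reverse (a b c d : Fin k) :
    count (fun x : Equiv.Perm (Fin k) => Above x a b ∧ Above x c d) =
      count (fun x : Equiv.Perm (Fin k) => Above x b a ∧ Above x d c) := by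
  rw [← count_equiv (Equiv.mulRight Fin.revPerm)
    (fun x : Equiv.Perm (Fin k) => Above x b a ∧ Above x d c)]
  simp only [Equiv.coe_mulRight, above_rev]

lemma lab_class {a b : Fin k} (hab : a ≠ b) :
    ∃ c : ℝ, 0 < c ∧ ∀ x, count (fun y => lab a b y = lab a b x) = c := by
  have e : count (fun y => lab a b y = false) = count (fun y => lab a b y = true) := by
    have := count_reverse b a b a
    simp only [and_self] at this
    simpa only [lab_false hab, lab_true] using this
  have hx : ∀ x, count (fun y => lab a b y = lab a b x) = count (fun y => lab a b y = true) := by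
    intro x
    cases h : lab a b x
    · exact e
    · rfl
  refine ⟨_, ?_, hx⟩
  rw [← hx 1]
  unfold count
  exact Nat.cast_pos.2 (Finset.card_pos.2 ⟨1, by simp⟩)

lemma corr_shared {a b c : Fin k} (hab : a ≠ b) (hac : a ≠ c) (hbc : b ≠ c) :
    CorrIneq (lab a b) (lab a c) := by
  have htf : count (fun x : Equiv.Perm (Fin k) => Above x a b ∧ Above x c a) =
      count (fun x : Equiv.Perm (Fin k) => Above x c b ∧ Above x a c) := by
    rw [count_relabel (Equiv.swap a c)]
    simp [Equiv.swap_apply_of_ne_of_ne hab.symm hbc]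
  have h2 : count (fun x : Equiv.Perm (Fin k) => Above x b c ∧ Above x a b) =
      count (fun x : Equiv.Perm (Fin k) => Above x c b ∧ Above x a c) := by
    rw [count_relabel (Equiv.swap b c)]
    simp [Equiv.swap_apply_of_ne_of_ne hab hac]
  apply corr_of_counts <;> simp only [lab_false hab, lab_false hac, lab_true]
  · exact count_reverse _ _ _ _
  · exact count_reverse _ _ _ _
  · have h3 : count (fun x : Equiv.Perm (Fin k) => Above x a b ∧ Above x a c) ≤
        count (fun x : Equiv.Perm (Fin k) => Above x b c ∧ Above x a b) +
        count (fun x : Equiv.Perm (Fin k) => Above x c b ∧ Above x a c) := by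
      refine le_trans (count_mono ?_) (count_or_le _ _)
      rintro x ⟨h, h'⟩
      by_cases hh : Above x b c
      · exact Or.inl ⟨hh, h⟩
      · exact Or.inr ⟨above_of_not hbc.symm hh, h'⟩
    rw [h2, ← htf] at h3
    linarith [count_nonneg (fun x : Equiv.Perm (Fin k) => Above x a b ∧ Above x c a)]
  · have h3 : count (fun x : Equiv.Perm (Fin k) => Above x c b ∧ Above x a c) ≤
        count (fun x : Equiv.Perm (Fin k) => Above x a b ∧ Above x a c) :=
      count_mono fun x h => ⟨lt_trans h.2 h.1, h.2⟩
    rw [← htf] at h3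
    linarith [count_nonneg (fun x : Equiv.Perm (Fin k) => Above x a b ∧ Above x a c)]

lemma corr_disjoint {a b c d : Fin k} (hab : a ≠ b) (hcd : c ≠ d) (hac : a ≠ c) (had : a ≠ d)
    (hbc : b ≠ c) (hbd : b ≠ d) : CorrIneq (lab a b) (lab c d) := by
  have htf : count (fun x : Equiv.Perm (Fin k) => Above x a b ∧ Above x c d) =
      count (fun x : Equiv.Perm (Fin k) => Above x a b ∧ Above x d c) := by
    rw [count_relabel (Equiv.swap c d)]
    simp [Equiv.swap_apply_of_ne_of_ne hac had, Equiv.swap_apply_of_ne_of_ne hbc hbd]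
  apply corr_of_counts <;> simp only [lab_false hab, lab_false hcd, lab_true]
  · exact count_reverse _ _ _ _
  · exact count_reverse _ _ _ _
  · rw [htf]
    linarith [count_nonneg (fun x : Equiv.Perm (Fin k) => Above x a b ∧ Above x d c)]
  · rw [htf]
    linarith [count_nonneg (fun x : Equiv.Perm (Fin k) => Above x a b ∧ Above x d c)]

/-- distinct pairs -/
lemma corr_pairs {q q' : Finset (Fin k)} (hq : q.card = 2) (hq' : q'.card = 2) (hne : q ≠ q') :
    ∃ a b c d, a ≠ b ∧ c ≠ d ∧ q = {a, b} ∧ q' = {c, d} ∧ CorrIneq (lab a b) (lab c d) := by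
  obtain ⟨a, b, hab, rfl⟩ := Finset.card_eq_two.1 hq
  obtain ⟨c, d, hcd, rfl⟩ := Finset.card_eq_two.1 hq'
  by_cases hac : a = c
  · subst hac
    have hbd : b ≠ d := by rintro rfl; exact hne rfl
    exact ⟨a, b, a, d, hab, hcd, rfl, rfl, corr_shared hab hcd hbd⟩
  by_cases had : a = d
  · subst had
    have hbc : b ≠ c := by rintro rfl; exact hne (Finset.pair_comm _ _)
    exact ⟨a, b, a, c, hab, hcd.symm, rfl, Finset.pair_comm _ _, corr_shared hab hcd.symm hbc⟩
  by_cases hbc : b = c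
  · subst hbc
    exact ⟨b, a, b, d, hab.symm, hcd, Finset.pair_comm _ _, rfl, corr_shared hab.symm hcd had⟩
  by_cases hbd : b = d
  · subst hbd
    exact ⟨b, a, b, c, hab.symm, hcd.symm, Finset.pair_comm _ _, Finset.pair_comm _ _,
      corr_shared hab.symm hcd.symm hac⟩
  exact ⟨a, b, c, d, hab, hcd, rfl, rfl, corr_disjoint hab hcd hac had hbc hbd⟩

end labels

/-! ### Boundaries -/

section final
variable {n k : ℕ}

lemma count_bad (f : Profile n k → Fin k) (i j : Fin n) (hij : i ≠ j) :
    count (Bad f i j) ≤ (Nat.factorial k : ℝ) ^ 2 * count (IsManipPoint f) := by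
  classical
  have hcard : Fintype.card (Equiv.Perm (Fin k)) = Nat.factorial k := by
    rw [Fintype.card_perm, Fintype.card_fin]
  let F : (Equiv.Perm (Fin k) × Equiv.Perm (Fin k)) × Profile n k → Profile n k :=
    fun p => Function.update (Function.update p.2 i p.1.1) j p.1.2
  have hsub : (Finset.univ.filter (Bad f i j)) ⊆
      (Finset.univ ×ˢ (Finset.univ.filter (IsManipPoint f))).image F := by
    intro σ hσ
    obtain ⟨x, y, h⟩ := (Finset.mem_filter.1 hσ).2
    refine Finset.mem_image.2 ⟨((σ i, σ j),
      Function.update (Function.update σ i x) j y), Finset.mem_product.2 ⟨Finset.mem_univ _,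
      Finset.mem_filter.2 ⟨Finset.mem_univ _, h⟩⟩, ?_⟩
    simp only [F]
    funext l
    by_cases hlj : l = j
    · subst hlj
      simp
    · by_cases hli : l = i
      · subst hli
        simp [hlj]
      · simp [hlj, hli]
  have h1 := (Finset.card_le_card hsub).trans Finset.card_image_le
  rw [Finset.card_product, Finset.card_univ, Fintype.card_prod, hcard] at h1
  unfold count
  have h2 : ((Finset.univ.filter (Bad f i j)).card : ℝ) ≤
      ((Nat.factorial k * Nat.factorial k * (Finset.univ.filter (IsManipPoint f)).card : ℕ) : ℝ) :=
    Nat.cast_le.2 h1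
  push_cast at h2
  rw [sq]
  convert h2

lemma R_line_three {f : Profile n k → Fin k} {i j : Fin n} (hij : i ≠ j) {σ : Profile n k}
    (hb : ¬ Bad f i j σ) (hR : 3 ≤ (R f i σ).card) (y) :
    R f i (Function.update σ j y) = R f i σ := by
  ext c
  simp only [mem_R, line_three hij hb hR y]

open Classical in
/-- the induced one-voter function, if it takes at least three values -/
noncomputable def dictFun (f : Profile n k → Fin k) (i : Fin n) (σ : Profile n k) :
    Option (Equiv.Perm (Fin k) → Fin k) :=
  if 3 ≤ (R f i σ).card then some (fun τ => f (Function.update σ i τ)) else none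

lemma dictFun_bd (f : Profile n k → Fin k) (i j : Fin n) (σ : Profile n k)
    (h : Bd (fun _ => ()) (dictFun f i) j σ) : i ≠ j ∧ Bad f i j σ := by
  obtain ⟨τ, -, hne⟩ := h
  have hij : i ≠ j := by
    rintro rfl
    apply hne
    simp [dictFun, R_update]
  refine ⟨hij, ?_⟩
  by_contra hb
  apply hne
  by_cases h3 : 3 ≤ (R f i σ).card
  · simp only [dictFun, R_line_three hij hb h3, line_three hij hb h3]
  · by_cases h3' : 3 ≤ (R f i (Function.update σ j τ)).card
    · exfalso
      have hb' : ¬ Bad f i j (Function.update σ j τ) := fun h => hb (bad_update h hij)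
      have := R_line_three hij hb' h3' (σ j)
      simp only [Function.update_idem, Function.update_eq_self] at this
      rw [← this] at h3'
      exact h3 h3'
    · simp [dictFun, h3, h3']

lemma pair_bd (f : Profile n k → Fin k) (i j : Fin n) {a b : Fin k} (hab : a ≠ b)
    (σ : Profile n k) (h : Bd (lab a b) (fun σ => R f i σ = {a, b}) j σ) :
    i ≠ j ∧ Bad f i j σ := by
  obtain ⟨τ, hl, hne⟩ := h
  have hij : i ≠ j := by
    rintro rfl
    apply hne
    simp [R_update]
  refine ⟨hij, ?_⟩
  by_contra hb
  apply hne
  have hl' : Above τ a b ↔ Above (σ j) a b := by rw [← lab_true, ← lab_true, hl]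
  have hb' : ¬ Bad f i j (Function.update σ j τ) := fun h => hb (bad_update h hij)
  refine propext ⟨fun h => ?_, fun h => line_two hij hb hab h hl'⟩
  have := line_two hij hb' hab h (y := σ j) (by simp [hl'])
  simpa using this

lemma sum_bad_le (f : Profile n k → Fin k) (i : Fin n) (p : Fin n → Profile n k → Prop)
    (hp : ∀ j σ, p j σ → i ≠ j ∧ Bad f i j σ) :
    ∑ j, count (p j) ≤ n * ((Nat.factorial k : ℝ) ^ 2 * count (IsManipPoint f)) := by
  have : ∀ j ∈ Finset.univ, count (p j) ≤
      (Nat.factorial k : ℝ) ^ 2 * count (IsManipPoint f) := by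
    intro j _
    by_cases hij : i = j
    · rw [count_false (fun σ h => (hp j σ h).1 hij)]
      exact mul_nonneg (by positivity) (count_nonneg _)
    · exact (count_mono fun σ h => (hp j σ h).2).trans (count_bad f i j hij)
  have := Finset.sum_le_card_nsmul _ _ _ this
  simpa using this

lemma card_profile : (Fintype.card (Profile n k) : ℝ) = (Nat.factorial k : ℝ) ^ n := by
  simp [Fintype.card_perm]

/-- distance hypothesis, unnormalized -/
lemma far_count {ε : ℝ} {f : Profile n k → Fin k}
    (hD : ∀ g : Profile n k → Fin k, InNonManipBar g →
      ε ≤ prob (fun σ : Profile n k => f σ ≠ g σ))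
    (g : Profile n k → Fin k) (hg : InNonManipBar g) :
    ε * (Nat.factorial k : ℝ) ^ n ≤ count (fun σ => f σ ≠ g σ) := by
  have h := hD g hg
  rw [prob_def, card_profile, le_div_iff₀ (by positivity)] at h
  exact h

lemma dict_bound {ε : ℝ} {f : Profile n k → Fin k}
    (hD : ∀ g : Profile n k → Fin k, InNonManipBar g →
      ε ≤ prob (fun σ : Profile n k => f σ ≠ g σ)) (i : Fin n) :
    count (fun σ => 3 ≤ (R f i σ).card) * ε ≤
      n * ((Nat.factorial k : ℝ) ^ 2 * count (IsManipPoint f)) := by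
  have hyb := hybrid_all (dictFun f i) Finset.univ
  have hs := sum_bad_le f i (fun j => Bd (fun _ => ()) (dictFun f i) j) (dictFun_bd f i)
  simp only [Finset.piecewise_univ] at hyb
  rw [Fintype.card_perm, Fintype.card_fin] at hyb
  have hW : (0 : ℝ) < (Nat.factorial k : ℝ) ^ n := by positivity
  have key : count (fun σ => 3 ≤ (R f i σ).card) * (ε * (Nat.factorial k : ℝ) ^ n) ≤
      ∑ σ, count (fun σ' => dictFun f i σ ≠ dictFun f i σ') := by
    refine count_mul_le_sum _ _ _ (fun _ => count_nonneg _) fun σ h3 => ?_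
    refine (far_count hD (fun σ' => f (Function.update σ i (σ' i)))
      (Or.inl ⟨i, fun s s' h => by simp only [h]⟩)).trans (count_mono fun σ' hne => ?_)
    intro he
    apply hne
    simp only [dictFun, h3, if_true] at he
    split_ifs at he with h3'
    have := congrFun (Option.some.inj he) (σ' i)
    simpa using this.symm
  have h2 := key.trans (hyb.trans (mul_le_mul_of_nonneg_left hs hW.le))
  refine le_of_mul_le_mul_right ?_ hW
  linarith

lemma bd_iff {β : Type*} (h : Profile n k → β) (j : Fin n) (σ : Profile n k) :
    Bd (fun _ => ()) h j σ ↔ ∃ τ, h (Function.update σ j τ) ≠ h σ := by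
  simp [Bd]

/-- each alternative pair misses a large boundary -/
lemma exists_pair_ne {ε : ℝ} (hk : 3 ≤ k) (hn : 2 ≤ n) (hε0 : 0 < ε) {f : Profile n k → Fin k}
    (hD : ∀ g : Profile n k → Fin k, InNonManipBar g →
      ε ≤ prob (fun σ : Profile n k => f σ ≠ g σ))
    (d : ℝ) (hd : ∀ i, count (fun σ => 3 ≤ (R f i σ).card) ≤ d)
    (hnd : n * d ≤ ε * (Nat.factorial k : ℝ) ^ n / (2 * k))
    (P : ℝ) (hP : P = ε * (Nat.factorial k : ℝ) ^ n / (4 * n * k ^ 2))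
    (q0 : Finset (Fin k)) (hq0 : q0.card = 2) :
    ∃ j q, q.card = 2 ∧ q ≠ q0 ∧ P ≤ count (fun σ => R f j σ = q) := by
  classical
  by_contra hcon
  push Not at hcon
  set W := (Nat.factorial k : ℝ) ^ n with hW
  have hWpos : 0 < W := by positivity
  have hkpos : (0 : ℝ) < k := by exact_mod_cast (by omega : 0 < k)
  have hnpos : (0 : ℝ) < n := by exact_mod_cast (by omega : 0 < n)
  obtain ⟨a, b, hab, rfl⟩ := Finset.card_eq_two.1 hq0
  obtain ⟨e, hea, heb, he⟩ : ∃ e, e ≠ a ∧ e ≠ b ∧ ε * W / k ≤ count (fun σ => f σ = e) := by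
    by_contra hno
    push Not at hno
    have h1 := far_count hD (fun σ => if f σ = b then b else a)
      (Or.inr ⟨a, b, fun σ => by by_cases h : f σ = b <;> simp [h]⟩)
    have h2 : count (fun σ => f σ ≠ if f σ = b then b else a) ≤
        ∑ e ∈ ({a, b} : Finset (Fin k))ᶜ, count (fun σ => f σ = e) := by
      refine le_trans (count_mono fun σ hσ => ?_) (count_exists_le _ _)
      refine ⟨f σ, ?_, rfl⟩
      by_cases h : f σ = b
      · simp [h] at hσ
      · simp only [h, if_false] at hσ
        simp [h, hσ]
    have h3 : ∑ e ∈ ({a, b} : Finset (Fin k))ᶜ, count (fun σ => f σ = e) <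
        ∑ e ∈ ({a, b} : Finset (Fin k))ᶜ, ε * W / k := by
      refine Finset.sum_lt_sum_of_nonempty ?_ fun e he => ?_
      · rw [← Finset.card_pos, Finset.card_compl, hq0, Fintype.card_fin]; omega
      · simp only [Finset.mem_compl, Finset.mem_insert, Finset.mem_singleton, not_or] at he
        exact hno e he.1 he.2
    have h4 : ∑ e ∈ ({a, b} : Finset (Fin k))ᶜ, ε * W / k ≤ ε * W := by
      rw [Finset.sum_const, nsmul_eq_mul]
      have : ((({a, b} : Finset (Fin k))ᶜ.card : ℕ) : ℝ) ≤ k := by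
        exact_mod_cast (Finset.card_le_univ _).trans (by simp)
      calc _ ≤ (k : ℝ) * (ε * W / k) := mul_le_mul_of_nonneg_right this (by positivity)
        _ = ε * W := by field_simp
    linarith
  have hne := far_count hD (fun _ => e) (Or.inr ⟨e, e, fun _ => Or.inl rfl⟩)
  have hnot := count_not (fun σ => f σ = e)
  rw [card_profile] at hnot
  have hyb := hybrid_all (fun σ => (f σ = e)) Finset.univ
  simp only [Finset.piecewise_univ] at hyb
  rw [Fintype.card_perm, Fintype.card_fin] at hyb
  set m := count (fun σ => f σ = e) with hm
  have hne' : ε * W ≤ W - m := by rw [← hnot]; exact hne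
  have hlow : m * (W - m) + (W - m) * m ≤
      ∑ σ, count (fun σ' : Profile n k => (f σ = e) ≠ (f σ' = e)) := by
    have h1 := count_mul_le_sum (fun σ => f σ = e)
      (fun σ => if f σ = e then count (fun σ' : Profile n k => (f σ = e) ≠ (f σ' = e)) else 0)
      (W - m) (fun σ => by split_ifs; exacts [count_nonneg _, le_rfl]) (fun σ h => by
        simp only [h, if_true]
        rw [← hnot]
        exact count_mono fun σ' h' => by simpa using h')
    have h2 := count_mul_le_sum (fun σ => ¬ f σ = e)
      (fun σ => if f σ = e then 0 else count (fun σ' : Profile n k => (f σ = e) ≠ (f σ' = e)))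
      m (fun σ => by split_ifs; exacts [le_rfl, count_nonneg _]) (fun σ h => by
        simp only [h, if_false]
        exact count_mono fun σ' h' => by simpa using h')
    rw [hnot] at h2
    have h3 := add_le_add h1 h2
    rw [← Finset.sum_add_distrib] at h3
    refine h3.trans (le_of_eq (Finset.sum_congr rfl fun σ _ => ?_))
    by_cases h : f σ = e <;> simp [h]
  have hB : ∀ j ∈ (Finset.univ : Finset (Fin n)),
      count (Bd (fun _ => ()) (fun σ : Profile n k => (f σ = e)) j) ≤ d + k * P := by
    intro j _
    have h1 : count (Bd (fun _ => ()) (fun σ : Profile n k => (f σ = e)) j) ≤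
        count (fun σ => 3 ≤ (R f j σ).card) +
        count (fun σ => ∃ e' ∈ Finset.univ.erase e, R f j σ = {e, e'}) := by
      refine le_trans (count_mono fun σ hσ => ?_) (count_or_le _ _)
      by_cases h3 : 3 ≤ (R f j σ).card
      · exact Or.inl h3
      right
      obtain ⟨τ, hτ⟩ := (bd_iff _ _ _).1 hσ
      have m1 : f σ ∈ R f j σ := self_mem_R _ _ _
      have m2 : f (Function.update σ j τ) ∈ R f j σ := mem_R.2 ⟨τ, rfl⟩
      obtain ⟨e', hne', hmem, hmem'⟩ : ∃ e', e' ≠ e ∧ e ∈ R f j σ ∧ e' ∈ R f j σ := by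
        by_cases h : f σ = e
        · refine ⟨f (Function.update σ j τ), fun h' => hτ (by simp [h, h']), h ▸ m1, m2⟩
        · refine ⟨f σ, h, ?_, m1⟩
          have : f (Function.update σ j τ) = e := by
            by_contra h'
            exact hτ (by simp [h, h'])
          exact this ▸ m2
      refine ⟨e', by simp [hne'], (Finset.eq_of_subset_of_card_le ?_ ?_).symm⟩
      · intro x hx
        simp only [Finset.mem_insert, Finset.mem_singleton] at hx
        rcases hx with rfl | rfl <;> assumption
      · rw [Finset.card_pair hne'.symm]; omega
    have h2 : count (fun σ => ∃ e' ∈ Finset.univ.erase e, R f j σ = {e, e'}) ≤ k * P := by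
      refine (count_exists_le _ _).trans ?_
      refine (Finset.sum_le_card_nsmul _ _ P fun e' he' => ?_).trans ?_
      · refine (hcon j {e, e'} (Finset.card_pair (Finset.ne_of_mem_erase he').symm) ?_).le
        intro h
        have : e ∈ ({a, b} : Finset (Fin k)) := by rw [← h]; simp
        simp [hea, heb] at this
      · rw [nsmul_eq_mul]
        refine mul_le_mul_of_nonneg_right ?_ (by rw [hP]; positivity)
        exact_mod_cast (Finset.card_le_univ _).trans (by simp)
    linarith [hd j]
  have hsum := Finset.sum_le_card_nsmul _ _ _ hB
  rw [Finset.card_univ, Fintype.card_fin, nsmul_eq_mul] at hsum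
  have hup := hlow.trans (hyb.trans (mul_le_mul_of_nonneg_left hsum hWpos.le))
  have hnkP : n * (k * P) = ε * W / (4 * k) := by rw [hP]; field_simp
  have hmW : m ≤ W := by have : 0 ≤ ε * W := by positivity
                         linarith
  have hb1 : ε * W / k ≤ ε * W := by
    apply div_le_self (by positivity)
    exact_mod_cast (by omega : 1 ≤ k)
  have hlow2 : (ε * W / k) * (W / 2) ≤ m * (W - m) := by
    have h0 : 0 ≤ ε * W / k := by positivity
    rcases le_total (W / 2) m with h | h
    · have := mul_le_mul h (hb1.trans hne') h0 (by linarith)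
      linarith
    · exact mul_le_mul he (by linarith) (by linarith) (by linarith)
  have hfin : (ε * W / k) * W ≤ W * (n * d + n * (k * P)) := by linarith
  have e2 : ε * W / (2 * k) = (ε * W / k) / 2 := by field_simp
  have e4 : ε * W / (4 * k) = (ε * W / k) / 4 := by field_simp
  rw [hnkP, e4] at hfin
  rw [e2] at hnd
  have hpos : 0 < ε * W / k := by positivity
  nlinarith

/-- each voter misses a large boundary -/
lemma exists_voter_ne {ε : ℝ} (hk : 3 ≤ k) (hn : 2 ≤ n) (hε0 : 0 < ε) {f : Profile n k → Fin k}
    (hD : ∀ g : Profile n k → Fin k, InNonManipBar g →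
      ε ≤ prob (fun σ : Profile n k => f σ ≠ g σ))
    (d : ℝ) (hd0 : 0 ≤ d) (hd : ∀ i, count (fun σ => 3 ≤ (R f i σ).card) ≤ d)
    (hnd : n * d ≤ ε * (Nat.factorial k : ℝ) ^ n / (2 * k))
    (P : ℝ) (hP : P = ε * (Nat.factorial k : ℝ) ^ n / (4 * n * k ^ 2))
    (i : Fin n) :
    ∃ j q, q.card = 2 ∧ i ≠ j ∧ P ≤ count (fun σ => R f j σ = q) := by
  classical
  by_contra hcon
  push Not at hcon
  set W := (Nat.factorial k : ℝ) ^ n with hW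
  have hWpos : 0 < W := by positivity
  have hkpos : (0 : ℝ) < k := by exact_mod_cast (by omega : 0 < k)
  have hnpos : (0 : ℝ) < n := by exact_mod_cast (by omega : 0 < n)
  have hyb := hybrid_all f (Finset.univ.erase i)
  rw [Fintype.card_perm, Fintype.card_fin] at hyb
  have hpw : ∀ σ σ' : Profile n k, (Finset.univ.erase i).piecewise σ' σ =
      Function.update σ' i (σ i) := by
    intro σ σ'
    ext1 j
    by_cases h : j = i
    · subst h; simp
    · simp [h]
  simp only [hpw] at hyb
  have hlow : W * (ε * W) ≤
      ∑ σ : Profile n k, count (fun σ' : Profile n k => f σ ≠ f (Function.update σ' i (σ i))) := by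
    have e1 : ∑ σ : Profile n k,
        count (fun σ' : Profile n k => f σ ≠ f (Function.update σ' i (σ i))) =
        ∑ σ' : Profile n k,
        count (fun σ : Profile n k => f σ ≠ f (Function.update σ' i (σ i))) := by
      simp only [count_def]
      rw [Finset.sum_comm]
    rw [e1]
    have := count_mul_le_sum (fun _ : Profile n k => True) (fun σ' : Profile n k =>
        count (fun σ : Profile n k => f σ ≠ f (Function.update σ' i (σ i)))) (ε * W)
        (fun _ => count_nonneg _) (fun σ' _ =>
          far_count hD (fun σ => f (Function.update σ' i (σ i)))
            (Or.inl ⟨i, fun s s' h => by simp only [h]⟩))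
    rwa [count_true, card_profile] at this
  have hB : ∀ j ∈ Finset.univ.erase i,
      count (Bd (fun _ => ()) f j) ≤ d + k * k * P := by
    intro j hj
    have hij : i ≠ j := (Finset.ne_of_mem_erase hj).symm
    have h1 : count (Bd (fun _ => ()) f j) ≤
        count (fun σ => 3 ≤ (R f j σ).card) +
        count (fun σ => ∃ e ∈ (Finset.univ : Finset (Fin k × Fin k)).filter (fun e => e.1 ≠ e.2),
          R f j σ = {e.1, e.2}) := by
      refine le_trans (count_mono fun σ hσ => ?_) (count_or_le _ _)
      by_cases h3 : 3 ≤ (R f j σ).card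
      · exact Or.inl h3
      right
      obtain ⟨τ, hτ⟩ := (bd_iff _ _ _).1 hσ
      have m1 : f σ ∈ R f j σ := self_mem_R _ _ _
      have m2 : f (Function.update σ j τ) ∈ R f j σ := mem_R.2 ⟨τ, rfl⟩
      refine ⟨(f (Function.update σ j τ), f σ), by simpa using hτ,
        (Finset.eq_of_subset_of_card_le ?_ ?_).symm⟩
      · intro x hx
        simp only [Finset.mem_insert, Finset.mem_singleton] at hx
        rcases hx with rfl | rfl <;> assumption
      · rw [Finset.card_pair hτ]; omega
    have h2 : count (fun σ => ∃ e ∈ (Finset.univ : Finset (Fin k × Fin k)).filter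
        (fun e => e.1 ≠ e.2), R f j σ = {e.1, e.2}) ≤ k * k * P := by
      refine (count_exists_le _ _).trans ?_
      refine (Finset.sum_le_card_nsmul _ _ P fun e he => ?_).trans ?_
      · exact (hcon j {e.1, e.2} (Finset.card_pair (Finset.mem_filter.1 he).2) hij).le
      · rw [nsmul_eq_mul]
        refine mul_le_mul_of_nonneg_right ?_ (by rw [hP]; positivity)
        exact_mod_cast (Finset.card_le_univ _).trans (by simp)
    linarith [hd j]
  have hsum := Finset.sum_le_card_nsmul _ _ _ hB
  have hPpos : 0 ≤ P := by rw [hP]; positivity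
  have hc : (((Finset.univ.erase i).card : ℕ) : ℝ) ≤ n := by
    exact_mod_cast (Finset.card_le_univ _).trans (by simp)
  rw [nsmul_eq_mul] at hsum
  have hsum' := hsum.trans (mul_le_mul_of_nonneg_right hc (by positivity))
  have hup := hlow.trans (hyb.trans (mul_le_mul_of_nonneg_left hsum' hWpos.le))
  have hnkP : n * (k * k * P) = ε * W / 4 := by rw [hP]; field_simp
  have hup' := le_of_mul_le_mul_left hup hWpos
  have hb1 : ε * W / (2 * k) ≤ ε * W / 2 := by
    apply div_le_div_of_nonneg_left (by positivity) (by positivity)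
    have : (1 : ℝ) ≤ k := by exact_mod_cast (by omega : 1 ≤ k)
    linarith
  have hpos : 0 < ε * W := by positivity
  linarith

/-- combine -/
lemma exists_two {ε : ℝ} (hk : 3 ≤ k) (hn : 2 ≤ n) (hε0 : 0 < ε) {f : Profile n k → Fin k}
    (hD : ∀ g : Profile n k → Fin k, InNonManipBar g →
      ε ≤ prob (fun σ : Profile n k => f σ ≠ g σ))
    (d : ℝ) (hd0 : 0 ≤ d) (hd : ∀ i, count (fun σ => 3 ≤ (R f i σ).card) ≤ d)
    (hnd : n * d ≤ ε * (Nat.factorial k : ℝ) ^ n / (2 * k))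
    (P : ℝ) (hP : P = ε * (Nat.factorial k : ℝ) ^ n / (4 * n * k ^ 2)) :
    ∃ i j q q', i ≠ j ∧ q.card = 2 ∧ q'.card = 2 ∧ q ≠ q' ∧
      P ≤ count (fun σ => R f i σ = q) ∧ P ≤ count (fun σ => R f j σ = q') := by
  have F1 := exists_pair_ne hk hn hε0 hD d hd hnd P hP
  have F2 := exists_voter_ne hk hn hε0 hD d hd0 hd hnd P hP
  obtain ⟨i, q, hq, -, hi⟩ := F2 ⟨0, by omega⟩
  obtain ⟨i', q', hq', hqq, hi'⟩ := F1 q hq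
  by_cases h : i = i'
  · subst h
    obtain ⟨j, r, hr, hij, hj⟩ := F2 i
    by_cases hqr : q = r
    · subst hqr
      exact ⟨i, j, q', q, hij, hq', hr, hqq, hi', hj⟩
    · exact ⟨i, j, q, r, hij, hq, hr, hqr, hi, hj⟩
  · exact ⟨i, i', q, q', h, hq, hq', hqq.symm, hi, hi'⟩


lemma boundaries_meet (hn : 2 ≤ n) {f : Profile n k → Fin k} {i j : Fin n} (hij : i ≠ j)
    {q q' : Finset (Fin k)} (hq : q.card = 2) (hq' : q'.card = 2) (hne : q ≠ q')
    (P β : ℝ) (hβ : β = n * ((Nat.factorial k : ℝ) ^ 2 * count (IsManipPoint f)))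
    (hPβ : 4 * β ≤ P) (hP0 : 0 ≤ P)
    (h1 : P ≤ count (fun σ => R f i σ = q)) (h2 : P ≤ count (fun σ => R f j σ = q')) :
    ((P / 2) ^ 2) ^ 2 ≤ ((Nat.factorial k : ℝ) ^ n) ^ 3 * (5 * β) := by
  obtain ⟨a, b, c, d, hab, hcd, rfl, rfl, hcorr⟩ := corr_pairs hq hq' hne
  obtain ⟨c1, hc1, hc1'⟩ := lab_class hab
  obtain ⟨c2, hc2, hc2'⟩ := lab_class hcd
  obtain ⟨T, hT⟩ := exists_label_set (lab a b) hc1 hc1' (fun σ : Profile n k => R f i σ = {a, b})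
  obtain ⟨S, hS⟩ := exists_label_set (lab c d) hc2 hc2' (fun σ : Profile n k => R f j σ = {c, d})
  have b1 := sum_bad_le f i _ (fun l σ => pair_bd f i l hab σ)
  have b2 := sum_bad_le f j _ (fun l σ => pair_bd f j l hcd σ)
  rw [← hβ] at b1 b2
  have hm := corr_main (lab a b) (lab c d) hcorr n T S
  rw [Fintype.card_perm, Fintype.card_fin] at hm
  have t1 : count (fun σ : Profile n k => R f i σ = {a, b}) ≤
      count (fun σ : Profile n k => T (lab a b ∘ σ)) + 2 * β := by
    refine le_trans (le_trans (count_mono fun σ h => ?_) (count_or_le _ _))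
      (add_le_add le_rfl (hT.trans (by linarith)))
    by_cases hh : T (lab a b ∘ σ)
    · exact Or.inl hh
    · exact Or.inr (Or.inl ⟨h, hh⟩)
  have t2 : count (fun σ : Profile n k => R f j σ = {c, d}) ≤
      count (fun σ : Profile n k => S (lab c d ∘ σ)) + 2 * β := by
    refine le_trans (le_trans (count_mono fun σ h => ?_) (count_or_le _ _))
      (add_le_add le_rfl (hS.trans (by linarith)))
    by_cases hh : S (lab c d ∘ σ)
    · exact Or.inl hh
    · exact Or.inr (Or.inl ⟨h, hh⟩)
  have t3 : count (fun σ : Profile n k => T (lab a b ∘ σ) ∧ S (lab c d ∘ σ)) ≤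
      count (Bad f i j) + (2 * β + 2 * β) := by
    refine le_trans (le_trans (count_mono fun σ h => ?_) (count_or_le _ _))
      (add_le_add le_rfl (le_trans (count_or_le _ _)
        (add_le_add (hT.trans (by linarith)) (hS.trans (by linarith)))))
    by_cases hA : R f i σ = {a, b}
    · by_cases hB : R f j σ = {c, d}
      · left
        by_contra hb
        have hsub := R_sub hij hb (by rw [hA, Finset.card_pair hab])
        have := Finset.eq_of_subset_of_card_le hsub (by
          rw [hA, hB, Finset.card_pair hab, Finset.card_pair hcd])
        rw [hA, hB] at this
        exact hne this.symm
      · exact Or.inr (Or.inr (Or.inr ⟨hB, h.2⟩))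
    · exact Or.inr (Or.inl (Or.inr ⟨hA, h.1⟩))
  have t4 : count (Bad f i j) ≤ β := by
    refine (count_bad f i j hij).trans ?_
    rw [hβ]
    have : (1 : ℝ) ≤ n := by exact_mod_cast (by omega : 1 ≤ n)
    exact le_mul_of_one_le_left (mul_nonneg (by positivity) (count_nonneg _)) this
  have hP2 : 0 ≤ P / 2 := by linarith
  have l1 : P / 2 ≤ count (fun σ : Profile n k => T (lab a b ∘ σ)) := by linarith
  have l2 : P / 2 ≤ count (fun σ : Profile n k => S (lab c d ∘ σ)) := by linarith
  have l3 := mul_le_mul l1 l2 hP2 (hP2.trans l1)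
  have l4 := pow_le_pow_left₀ (mul_nonneg hP2 hP2) l3 2
  rw [sq (P / 2)]
  refine l4.trans (hm.trans (mul_le_mul_of_nonneg_left ?_ (by positivity)))
  linarith

end final

end QGS

theorem stmt3 (n k : ℕ) (hn : 2 ≤ n) (hk : 3 ≤ k)
    (ε : ℝ) (hε0 : 0 < ε) (hε1 : ε ≤ 1)
    (f : Profile n k → Fin k)
    (hD : ∀ g : Profile n k → Fin k, InNonManipBar g →
      ε ≤ prob (fun σ : Profile n k => f σ ≠ g σ)) :
    ε ^ 5 / (4 * (n : ℝ) ^ 7 * (k : ℝ) ^ 12 * (Nat.factorial k : ℝ) ^ 4) ≤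
      prob (fun σ : Profile n k => IsManipPoint f σ) := by
  have hN6 : (6 : ℝ) ≤ (Nat.factorial k : ℝ) := by
    have : Nat.factorial 3 ≤ Nat.factorial k := Nat.factorial_le hk
    exact_mod_cast this
  have hk3 : (3 : ℝ) ≤ k := by exact_mod_cast hk
  have hn2 : (2 : ℝ) ≤ n := by exact_mod_cast hn
  rw [QGS.prob_def, QGS.card_profile]
  set W := (Nat.factorial k : ℝ) ^ n with hW
  have hWpos : 0 < W := by positivity
  by_contra hcon
  rw [not_le, div_lt_iff₀ hWpos] at hcon
  set m := count (fun σ : Profile n k => IsManipPoint f σ) with hm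
  have hm0 : 0 ≤ m := QGS.count_nonneg _
  set N := (Nat.factorial k : ℝ) with hN
  set β : ℝ := n * (N ^ 2 * m) with hβ
  have hβ0 : 0 ≤ β := by positivity
  have hsmall : 20480 * ((n : ℝ) ^ 4 * (k : ℝ) ^ 8) * β < ε ^ 4 * W := by
    have h1 : β < ε ^ 5 * W / (4 * (n : ℝ) ^ 6 * (k : ℝ) ^ 12 * N ^ 2) := by
      have h2 : n * (N ^ 2 * m) <
          n * (N ^ 2 * (ε ^ 5 / (4 * (n : ℝ) ^ 7 * (k : ℝ) ^ 12 * N ^ 4) * W)) := by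
        gcongr
      refine h2.trans_le (le_of_eq ?_)
      field_simp
    have h3 : (5120 : ℝ) ≤ (n : ℝ) ^ 2 * (k : ℝ) ^ 4 * N ^ 2 := by
      calc (5120 : ℝ) ≤ 2 ^ 2 * 3 ^ 4 * 6 ^ 2 := by norm_num
        _ ≤ _ := by gcongr
    rw [lt_div_iff₀ (by positivity)] at h1
    have h4 : ε ^ 5 * W ≤ ε ^ 4 * W :=
      mul_le_mul_of_nonneg_right (pow_le_pow_of_le_one hε0.le hε1 (by norm_num)) hWpos.le
    refine lt_of_le_of_lt ?_ (h1.trans_le h4)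
    have h5 : 0 ≤ 4 * ((n : ℝ) ^ 4 * (k : ℝ) ^ 8) * β := by positivity
    calc 20480 * ((n : ℝ) ^ 4 * (k : ℝ) ^ 8) * β
        = 5120 * (4 * ((n : ℝ) ^ 4 * (k : ℝ) ^ 8) * β) := by ring
      _ ≤ ((n : ℝ) ^ 2 * (k : ℝ) ^ 4 * N ^ 2) * (4 * ((n : ℝ) ^ 4 * (k : ℝ) ^ 8) * β) :=
          mul_le_mul_of_nonneg_right h3 h5
      _ = _ := by ring
  have hk1 : (1 : ℝ) ≤ k := by linarith
  have hn1 : (1 : ℝ) ≤ n := by linarith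
  have hc1 : n * (β / ε) ≤ ε * W / (2 * k) := by
    rw [← mul_div_assoc, div_le_div_iff₀ hε0 (by positivity)]
    have h1 : ε ^ 4 * W ≤ ε ^ 2 * W :=
      mul_le_mul_of_nonneg_right (pow_le_pow_of_le_one hε0.le hε1 (by norm_num)) hWpos.le
    have h2 : (n : ℝ) * k ≤ (n : ℝ) ^ 4 * (k : ℝ) ^ 8 := by
      gcongr
      · exact le_self_pow₀ hn1 (by norm_num)
      · exact le_self_pow₀ hk1 (by norm_num)
    have h3 := mul_le_mul_of_nonneg_right h2 hβ0
    have h4 : 0 ≤ (n : ℝ) * k * β := by positivity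
    linarith
  have hc2 : 4 * β ≤ ε * W / (4 * n * k ^ 2) := by
    rw [le_div_iff₀ (by positivity)]
    have h1 : ε ^ 4 * W ≤ ε ^ 1 * W :=
      mul_le_mul_of_nonneg_right (pow_le_pow_of_le_one hε0.le hε1 (by norm_num)) hWpos.le
    have h2 : (n : ℝ) * k ^ 2 ≤ (n : ℝ) ^ 4 * (k : ℝ) ^ 8 := by
      gcongr
      · exact le_self_pow₀ hn1 (by norm_num)
      · norm_num
    have h3 := mul_le_mul_of_nonneg_right h2 hβ0
    have h4 : 0 ≤ (n : ℝ) * k ^ 2 * β := by positivity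
    linarith
  obtain ⟨i, j, q, q', hij, hq, hq', hne, h1, h2⟩ := QGS.exists_two hk hn hε0 hD (β / ε)
    (by positivity) (fun i => by rw [le_div_iff₀ hε0]; exact QGS.dict_bound hD i) hc1 _ rfl
  have hmeet := QGS.boundaries_meet hn hij hq hq' hne _ β hβ hc2 (by positivity) h1 h2
  have e1 : ((ε * W / (4 * n * k ^ 2) / 2) ^ 2) ^ 2 =
      W ^ 3 * (ε ^ 4 * W / (4096 * ((n : ℝ) ^ 4 * (k : ℝ) ^ 8))) := by
    field_simp
    norm_num
  rw [e1] at hmeet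
  have hmeet' := le_of_mul_le_mul_left hmeet (by positivity)
  rw [div_le_iff₀ (by positivity)] at hmeet'
  linarith
end
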